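/- arXiv:2511.06543 — 2 statements merged into one kernel-verified Lean document; each statement's English description precedes it below -/
import Mathlib

section
/- Let K be a compact subset of the unit circle of arclength measure 0. Then the set 𝒰_K of functions f in the closed unit ball of H^∞ such that for every continuous φ : K → ℂ with sup_K |φ| ≤ 1 there exists a sequence (r_n) in (0,1) converging to 1 with sup_{z∈K} |f(r_n z) − φ(z)| → 0, is a dense G_δ subset of the closed unit ball of H^∞ endowed with the topology of locally uniform convergence on the open unit disc. -/
open Complex Metric MeasureTheory Filter Set

noncomputable section

/-- A finite Blaschke product: a unimodular constant times a finite product of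
disc automorphisms `z ↦ (z - wₖ)/(1 - conj wₖ · z)` with `wₖ` in the open unit disc. -/
def IsFiniteBlaschke (B : ℂ → ℂ) : Prop :=
  ∃ (n : ℕ) (ζ : ℂ) (w : Fin (n + 1) → ℂ),
    ‖ζ‖ = 1 ∧ (∀ k, ‖w k‖ < 1) ∧
    ∀ z : ℂ, B z = ζ * ∏ k, (z - w k) / (1 - (starRingEnd ℂ) (w k) * z)

/-- Arclength measure on the unit circle, viewed as a measure on `ℂ`. -/
def arclength : Measure ℂ :=
  Measure.map (circleMap 0 1) (volume.restrict (Set.Ioc 0 (2 * Real.pi)))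

/-- The family of compact subsets of the open unit disc. -/
def discCompacts : Set (Set ℂ) := {L | L ⊆ Metric.ball (0:ℂ) 1 ∧ IsCompact L}

/-- The closed unit ball `𝓑` of `H^∞`, as a subset of the space of functions `ℂ → ℂ`
equipped with the topology of uniform convergence on compact subsets of the open unit disc
(locally uniform convergence on `𝔻`). -/
def HinftyBall : Set (UniformOnFun ℂ ℂ discCompacts) :=
  {f | DifferentiableOn ℂ (UniformOnFun.toFun discCompacts f) (Metric.ball (0:ℂ) 1) ∧
       ∀ z ∈ Metric.ball (0:ℂ) 1, ‖UniformOnFun.toFun discCompacts f z‖ ≤ 1}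

/-- The class `𝒰_K ⊆ 𝓑` of radially universal functions for `K`. -/
def UnivClass (K : Set ℂ) : Set ↥HinftyBall :=
  {f | ∀ φ : ℂ → ℂ, ContinuousOn φ K → (∀ z ∈ K, ‖φ z‖ ≤ 1) →
    ∃ r : ℕ → ℝ, (∀ n, r n ∈ Set.Ioo (0:ℝ) 1) ∧ Tendsto r atTop (nhds 1) ∧
      Tendsto (fun n => ⨆ z ∈ K,
          ‖UniformOnFun.toFun discCompacts f.1 ((r n : ℂ) * z) - φ z‖)
        atTop (nhds 0)}

open scoped ENNReal MeasureTheory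

/-- A compact subset of the circle of arclength zero has one-dimensional Hausdorff measure zero. -/
lemma hausdorffMeasure_one_eq_zero_of_arclength {K : Set ℂ} (hKc : IsCompact K)
    (hKs : K ⊆ Metric.sphere (0:ℂ) 1) (hK0 : arclength K = 0) : (μH[1] : Measure ℂ) K = 0 := by
  have hm : Measurable (circleMap 0 1) := (continuous_circleMap 0 1).measurable
  have hpre : MeasurableSet (circleMap 0 1 ⁻¹' K) := hm hKc.isClosed.measurableSet
  rw [arclength, Measure.map_apply hm hKc.isClosed.measurableSet,
    Measure.restrict_apply hpre, ← hausdorffMeasure_real] at hK0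
  have hsub : K ⊆ circleMap 0 1 '' (circleMap 0 1 ⁻¹' K ∩ Set.Ioc 0 (2 * Real.pi)) := by
    intro z hz
    have h1 : z ∈ circleMap 0 1 '' Set.Ioc 0 (2 * Real.pi) := by
      rw [image_circleMap_Ioc]
      simpa using hKs hz
    obtain ⟨t, ht, rfl⟩ := h1
    exact ⟨t, ⟨hz, ht⟩, rfl⟩
  refine measure_mono_null hsub (le_antisymm ?_ zero_le)
  refine ((lipschitzWith_circleMap 0 1).hausdorffMeasure_image_le zero_le_one _).trans ?_
  rw [hK0, mul_zero]

/-- A set of one-dimensional Hausdorff measure zero in `ℂ` is totally disconnected. -/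
lemma isTotallyDisconnected_of_hausdorffMeasure_one {K : Set ℂ} (hK : (μH[1] : Measure ℂ) K = 0) :
    IsTotallyDisconnected K := by
  have key : ∀ (f : ℂ → ℝ), LipschitzWith 1 f → ∀ t ⊆ K, IsPreconnected t →
      (f '' t).Subsingleton := by
    intro f hf t ht hp
    have h0 : volume (f '' t) = 0 := by
      rw [← hausdorffMeasure_real]
      refine le_antisymm ((hf.hausdorffMeasure_image_le zero_le_one t).trans ?_) zero_le
      rw [measure_mono_null ht hK, mul_zero]
    have hpc : (f '' t).OrdConnected :=
      (hp.image f hf.continuous.continuousOn).ordConnected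
    intro x hx y hy
    by_contra hne
    wlog hlt : x < y generalizing x y
    · exact this hy hx (Ne.symm hne) (lt_of_le_of_ne (not_lt.mp hlt) (Ne.symm hne))
    have h1 := measure_mono_null (hpc.out hx hy) h0
    rw [Real.volume_Icc, ENNReal.ofReal_eq_zero] at h1
    linarith
  intro t ht hp x hx y hy
  refine Complex.ext ?_ ?_
  · refine key Complex.re ?_ t ht hp (mem_image_of_mem _ hx) (mem_image_of_mem _ hy)
    exact LipschitzWith.of_dist_le_mul fun a b => by
      simpa [dist_eq_norm] using Complex.abs_re_le_norm (a - b)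
  · refine key Complex.im ?_ t ht hp (mem_image_of_mem _ hx) (mem_image_of_mem _ hy)
    exact LipschitzWith.of_dist_le_mul fun a b => by
      simpa [dist_eq_norm] using Complex.abs_im_le_norm (a - b)

/-- A compact set of one-dimensional Hausdorff measure zero is covered by finitely many balls
centred on it with arbitrarily small sum of radii. -/
lemma exists_finite_cover_sum_lt {K : Set ℂ} (hKc : IsCompact K) (hK : (μH[1] : Measure ℂ) K = 0)
    {δ : ℝ} (hδ : 0 < δ) :
    ∃ (s : Finset ℕ) (a : ℕ → ℂ) (l : ℕ → ℝ), (∀ k ∈ s, a k ∈ K) ∧ (∀ k ∈ s, 0 < l k) ∧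
      ∑ k ∈ s, l k < δ ∧ ∀ z ∈ K, ∃ k ∈ s, dist z (a k) < l k := by
  have hK1 := hK
  rw [Measure.hausdorffMeasure_apply] at hK1
  simp only [ENNReal.iSup_eq_zero] at hK1
  have hlt := hK1 1 one_pos
  have hδ2 : (0 : ℝ≥0∞) < ENNReal.ofReal (δ / 2) := by simpa using hδ
  rw [← hlt] at hδ2
  simp only [iInf_lt_iff] at hδ2
  obtain ⟨t, hcov, hdiam, hsum⟩ := hδ2
  simp only [ENNReal.rpow_one] at hsum
  have hfin : ∀ n, Metric.ediam (t n) ≠ ⊤ := fun n =>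
    ne_top_of_le_ne_top ENNReal.one_ne_top (hdiam n)
  obtain ⟨e, he0, c, hec, hcd⟩ := posSumOfEncodable (show 0 < δ / 4 by positivity) ℕ
  let l : ℕ → ℝ := fun n => (Metric.ediam (t n)).toReal + e n
  classical
  let a : ℕ → ℂ := fun n => if h : (t n ∩ K).Nonempty then h.some else 0
  have hl : ∀ n, 0 < l n := fun n => add_pos_of_nonneg_of_pos ENNReal.toReal_nonneg (he0 n)
  have hcover : K ⊆ ⋃ n : {n // (t n ∩ K).Nonempty}, Metric.ball (a n) (l n) := by
    intro z hz
    obtain ⟨n, hn⟩ := mem_iUnion.mp (hcov hz)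
    have hne : (t n ∩ K).Nonempty := ⟨z, hn, hz⟩
    refine mem_iUnion.mpr ⟨⟨n, hne⟩, ?_⟩
    have ha : a n ∈ t n := by simp only [a, hne, dif_pos]; exact hne.some_mem.1
    have h1 : edist z (a n) ≤ Metric.ediam (t n) := Metric.edist_le_ediam_of_mem hn ha
    have h2 : dist z (a n) ≤ (Metric.ediam (t n)).toReal := by
      rw [dist_edist]; exact ENNReal.toReal_mono (hfin n) h1
    exact mem_ball.mpr (lt_of_le_of_lt h2 (lt_add_of_pos_right _ (he0 n)))
  obtain ⟨s, hs⟩ := hKc.elim_finite_subcover _ (fun _ => isOpen_ball) hcover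
  refine ⟨s.image Subtype.val, a, l, ?_, fun k _ => hl k, ?_, ?_⟩
  · intro k hk
    obtain ⟨⟨n, hn⟩, -, rfl⟩ := Finset.mem_image.mp hk
    simp only [a, hn, dif_pos]
    exact hn.some_mem.2
  · have hD : ∑ k ∈ s.image Subtype.val, (Metric.ediam (t k)).toReal ≤ δ / 2 := by
      rw [← ENNReal.toReal_sum fun n _ => hfin n]
      refine ENNReal.toReal_le_of_le_ofReal (half_pos hδ).le (le_trans ?_ hsum.le)
      refine le_trans (Finset.sum_le_sum fun k hk => ?_) (ENNReal.sum_le_tsum (s.image Subtype.val))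
      obtain ⟨⟨n, hn⟩, -, rfl⟩ := Finset.mem_image.mp hk
      exact le_iSup (fun _ : (t n).Nonempty => Metric.ediam (t n)) hn.left
    have hE : ∑ k ∈ s.image Subtype.val, e k ≤ c :=
      sum_le_hasSum _ (fun k _ => (he0 k).le) hec
    simp only [l, Finset.sum_add_distrib]
    linarith
  · intro z hz
    obtain ⟨n, hn⟩ := mem_iUnion.mp (hs hz)
    obtain ⟨hns, hzn⟩ := mem_iUnion.mp hn
    exact ⟨n, Finset.mem_image_of_mem _ hns, hzn⟩

/-- The Herglotz kernel is bounded below on the ball of radius `l` centred at `a`, when its pole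
is moved to `(1 + l) a`. -/
lemma le_re_herglotz {a z : ℂ} {l : ℝ} (ha : ‖a‖ = 1) (hl : 0 < l) (hz : ‖z‖ ≤ 1) :
    0 < ((((1 + l : ℝ) : ℂ) * a + z) / (((1 + l : ℝ) : ℂ) * a - z)).re ∧
      (dist z a < l → ‖z‖ = 1 →
        1 / (2 * l) ≤ ((((1 + l : ℝ) : ℂ) * a + z) / (((1 + l : ℝ) : ℂ) * a - z)).re) := by
  set p : ℂ := ((1 + l : ℝ) : ℂ) * a with hp
  have hpn : ‖p‖ = 1 + l := by
    rw [hp, norm_mul, ha, mul_one, Complex.norm_real, Real.norm_of_nonneg (by linarith)]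
  have hpz : 0 < ‖p - z‖ := by
    have := norm_sub_norm_le p z
    linarith
  have hre : ((p + z) / (p - z)).re = (‖p‖ ^ 2 - ‖z‖ ^ 2) / ‖p - z‖ ^ 2 := by
    rw [Complex.div_re, ← Complex.normSq_eq_norm_sq, ← Complex.normSq_eq_norm_sq,
      ← Complex.normSq_eq_norm_sq, ← add_div]
    congr 1
    simp only [Complex.add_re, Complex.sub_re, Complex.add_im, Complex.sub_im,
      Complex.normSq_apply]
    ring
  rw [hre, hpn]
  refine ⟨div_pos (by nlinarith [norm_nonneg z]) (by positivity), fun hd hz1 => ?_⟩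
  have h2 : ‖p - z‖ ≤ 2 * l := by
    have : p - z = (a - z) + (l : ℂ) * a := by rw [hp]; push_cast; ring
    rw [this]
    refine (norm_add_le _ _).trans ?_
    rw [norm_mul, ha, Complex.norm_real, Real.norm_of_nonneg hl.le, ← dist_eq_norm, dist_comm]
    linarith
  rw [hz1, div_le_div_iff₀ (by positivity) (by positivity)]
  nlinarith [pow_le_pow_left₀ hpz.le h2 2, pow_pos hl 3]

/-- A holomorphic function of positive real part which is large on a null compact subset of the
circle and small on a disjoint compact set. -/
lemma exists_pos_re_large_small {K K' : Set ℂ} (hKc : IsCompact K)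
    (hKs : K ⊆ Metric.sphere (0:ℂ) 1) (hK : (μH[1] : Measure ℂ) K = 0)
    (hK'c : IsCompact K') (hK' : K' ⊆ Metric.closedBall (0:ℂ) 1) (hdis : Disjoint K K')
    {M m : ℝ} (hM : 0 < M) (hm : 0 < m) :
    ∃ H : ℂ → ℂ, DiffContOnCl ℂ H (Metric.ball 0 1) ∧
      (∀ z ∈ Metric.closedBall (0:ℂ) 1, 0 < (H z).re) ∧
      (∀ z ∈ K, M ≤ ‖H z‖) ∧ ∀ z ∈ K', ‖H z‖ ≤ m := by
  obtain ⟨d, hd0, hd⟩ : ∃ d > 0, ∀ x ∈ K, ∀ y ∈ K', d ≤ dist x y := by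
    obtain ⟨r, hr0, hr⟩ := hdis.exists_thickenings hKc hK'c.isClosed
    refine ⟨r, hr0, fun x hx y hy => ?_⟩
    by_contra! h
    exact Set.disjoint_left.mp hr (mem_thickening_iff.mpr ⟨x, hx, by rwa [dist_comm]⟩)
      (self_subset_thickening hr0 _ hy)
  have hδ : 0 < min (min 1 (d / 2)) (m * d / (24 * M)) := by positivity
  obtain ⟨s, a, l, haK, hl0, hsum, hcov⟩ := exists_finite_cover_sum_lt hKc hK hδ
  have hδ1 : ∑ k ∈ s, l k < 1 := hsum.trans_le ((min_le_left _ _).trans (min_le_left _ _))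
  have hδ2 : ∑ k ∈ s, l k < d / 2 := hsum.trans_le ((min_le_left _ _).trans (min_le_right _ _))
  have hδ3 : ∑ k ∈ s, l k < m * d / (24 * M) := hsum.trans_le (min_le_right _ _)
  have hle : ∀ k ∈ s, l k ≤ ∑ k ∈ s, l k := fun k hk =>
    Finset.single_le_sum (f := l) (fun i hi => (hl0 i hi).le) hk
  have hna : ∀ k ∈ s, ‖a k‖ = 1 := fun k hk => by simpa using hKs (haK k hk)
  let p : ℕ → ℂ := fun k => ((1 + l k : ℝ) : ℂ) * a k
  have hpn : ∀ k ∈ s, ‖p k‖ = 1 + l k := fun k hk => by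
    simp only [p]
    rw [norm_mul, hna k hk, mul_one, Complex.norm_real,
      Real.norm_of_nonneg (by linarith [hl0 k hk])]
  have hpz : ∀ k ∈ s, ∀ z ∈ Metric.closedBall (0:ℂ) 1, p k - z ≠ 0 := by
    intro k hk z hz h
    have hz1 : ‖z‖ ≤ 1 := by simpa using hz
    rw [← sub_eq_zero.mp h, hpn k hk] at hz1
    linarith [hl0 k hk]
  let H : ℂ → ℂ := fun z => ((m / 2 : ℝ) : ℂ) +
    ∑ k ∈ s, ((2 * M * l k : ℝ) : ℂ) * ((p k + z) / (p k - z))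
  have hre : ∀ z, (H z).re = m / 2 + ∑ k ∈ s, 2 * M * l k * ((p k + z) / (p k - z)).re := by
    intro z
    simp only [H, Complex.add_re, Complex.ofReal_re, Complex.re_sum, Complex.re_ofReal_mul]
  have hnn : ∀ z ∈ Metric.closedBall (0:ℂ) 1, ∀ k ∈ s,
      0 ≤ 2 * M * l k * ((p k + z) / (p k - z)).re := fun z hz k hk =>
    mul_nonneg (by have := hl0 k hk; positivity)
      (le_re_herglotz (hna k hk) (hl0 k hk) (by simpa using hz)).1.le
  refine ⟨H, ?_, ?_, ?_, ?_⟩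
  · refine DifferentiableOn.diffContOnCl fun z hz => ?_
    rw [closure_ball _ one_ne_zero] at hz
    refine DifferentiableAt.differentiableWithinAt ?_
    refine (differentiableAt_const _).add (DifferentiableAt.fun_sum fun k hk => ?_)
    refine (differentiableAt_const _).mul (DifferentiableAt.div ?_ ?_ (hpz k hk z hz)) <;> fun_prop
  · intro z hz
    rw [hre]
    have := Finset.sum_nonneg (hnn z hz)
    linarith
  · intro z hz
    have hzs := hKs hz
    have hzc := sphere_subset_closedBall hzs
    obtain ⟨k, hk, hzk⟩ := hcov z hz
    refine le_trans ?_ (Complex.re_le_norm _)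
    rw [hre]
    have h1 := Finset.single_le_sum (hnn z hzc) hk
    have h2 := (le_re_herglotz (hna k hk) (hl0 k hk) (by simpa using hzc)).2 hzk (by simpa using hzs)
    have h3 : M = 2 * M * l k * (1 / (2 * l k)) := by
      have := (hl0 k hk).ne'
      field_simp
    have h4 : 2 * M * l k * (1 / (2 * l k)) ≤ 2 * M * l k * ((p k + z) / (p k - z)).re :=
      mul_le_mul_of_nonneg_left h2 (by have := hl0 k hk; positivity)
    linarith
  · intro z hz
    have hz1 : ‖z‖ ≤ 1 := by simpa using hK' hz
    have hterm : ∀ k ∈ s, ‖((2 * M * l k : ℝ) : ℂ) * ((p k + z) / (p k - z))‖ ≤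
        12 * M / d * l k := by
      intro k hk
      have hlk := hl0 k hk
      have h1 : ‖p k + z‖ ≤ 3 := by
        refine (norm_add_le _ _).trans ?_
        rw [hpn k hk]
        linarith [hle k hk]
      have h2 : d / 2 ≤ ‖p k - z‖ := by
        have e : p k - z = (a k - z) - -((l k : ℂ) * a k) := by simp only [p]; push_cast; ring
        have h3 := norm_sub_norm_le (a k - z) (-((l k : ℂ) * a k))
        rw [← e, norm_neg, norm_mul, hna k hk, Complex.norm_real, Real.norm_of_nonneg hlk.le,
          ← dist_eq_norm] at h3
        linarith [hd _ (haK k hk) z hz, hle k hk]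
      rw [norm_mul, norm_div, Complex.norm_real, Real.norm_of_nonneg (by positivity)]
      calc 2 * M * l k * (‖p k + z‖ / ‖p k - z‖) ≤ 2 * M * l k * (3 / (d / 2)) := by gcongr
        _ = 12 * M / d * l k := by field_simp; ring
    calc ‖H z‖ ≤ ‖((m / 2 : ℝ) : ℂ)‖ + ∑ k ∈ s, 12 * M / d * l k :=
          (norm_add_le _ _).trans (add_le_add le_rfl (norm_sum_le_of_le _ hterm))
      _ = m / 2 + 12 * M / d * ∑ k ∈ s, l k := by
          rw [Complex.norm_real, Real.norm_of_nonneg (by positivity), Finset.mul_sum]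
      _ ≤ m / 2 + 12 * M / d * (m * d / (24 * M)) := by gcongr
      _ = m := by field_simp; ring

/-- A holomorphic almost-characteristic function of a null compact subset of the circle, with
values close to the segment `[0, 1]`. -/
lemma exists_bump {K K' : Set ℂ} (hKc : IsCompact K)
    (hKs : K ⊆ Metric.sphere (0:ℂ) 1) (hK : (μH[1] : Measure ℂ) K = 0)
    (hK'c : IsCompact K') (hK' : K' ⊆ Metric.closedBall (0:ℂ) 1) (hdis : Disjoint K K')
    {ε : ℝ} (hε : 0 < ε) :
    ∃ q : ℂ → ℂ, DiffContOnCl ℂ q (Metric.ball 0 1) ∧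
      (∀ z ∈ Metric.closedBall (0:ℂ) 1, ‖q z‖ + ‖1 - q z‖ ≤ 1 + ε) ∧
      (∀ z ∈ K, ‖1 - q z‖ ≤ ε) ∧ ∀ z ∈ K', ‖q z‖ ≤ ε := by
  obtain ⟨α, hα0, hα1, hαc⟩ : ∃ α : ℝ, 0 < α ∧ α ≤ 1 ∧ 1 / (1 + ε) ≤ Real.cos (α * (Real.pi / 2)) := by
    have hc : Tendsto (fun α : ℝ => Real.cos (α * (Real.pi / 2))) (nhdsWithin 0 (Set.Ioi 0))
        (nhds 1) := by
      have : Continuous fun α : ℝ => Real.cos (α * (Real.pi / 2)) := by fun_prop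
      simpa using (this.tendsto 0).mono_left nhdsWithin_le_nhds
    have h1 : 1 / (1 + ε) < 1 := by rw [div_lt_one (by linarith)]; linarith
    obtain ⟨α, h, h'⟩ := ((hc.eventually (lt_mem_nhds h1)).and
      (Ioc_mem_nhdsGT (zero_lt_one' ℝ))).exists
    exact ⟨α, h'.1, h'.2, h.le⟩
  obtain ⟨H, hHd, hHre, hHK, hHK'⟩ := exists_pos_re_large_small hKc hKs hK hK'c hK' hdis
    (M := (1 + 1 / ε) ^ (1 / α)) (m := ε ^ (1 / α)) (by positivity) (by positivity)
  let w : ℂ → ℂ := fun z => H z ^ (α : ℂ)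
  have hH0 : ∀ z ∈ Metric.closedBall (0:ℂ) 1, H z ≠ 0 := fun z hz h => by
    have := hHre z hz
    simp [h] at this
  have hwn : ∀ z ∈ Metric.closedBall (0:ℂ) 1, ‖w z‖ = ‖H z‖ ^ α := fun z hz => by
    simp only [w]
    rw [Complex.norm_cpow_of_ne_zero (hH0 z hz)]
    simp
  have hwre : ∀ z ∈ Metric.closedBall (0:ℂ) 1, 1 / (1 + ε) * ‖w z‖ ≤ (w z).re := by
    intro z hz
    have harg : |(H z).arg| ≤ Real.pi / 2 := Complex.abs_arg_le_pi_div_two_iff.mpr (hHre z hz).le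
    have e : (w z).re = ‖w z‖ * Real.cos (α * (H z).arg) := by
      have : ‖w z‖ = ‖H z‖ ^ α := hwn z hz
      rw [this, mul_comm α]
      exact Complex.cpow_ofReal_re _ _
    rw [e, mul_comm]
    refine mul_le_mul_of_nonneg_left (hαc.trans ?_) (norm_nonneg _)
    rw [← Real.cos_abs (α * (H z).arg), abs_mul, abs_of_pos hα0]
    refine Real.cos_le_cos_of_nonneg_of_le_pi (by positivity) ?_ (by gcongr)
    nlinarith [Real.pi_pos]
  have h1w : ∀ z ∈ Metric.closedBall (0:ℂ) 1, (1 + ‖w z‖) / (1 + ε) ≤ ‖1 + w z‖ := by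
    intro z hz
    refine le_trans ?_ (Complex.re_le_norm _)
    have h1 : 1 / (1 + ε) ≤ 1 := by rw [div_le_one (by linarith)]; linarith
    have := hwre z hz
    rw [Complex.add_re, Complex.one_re]
    calc (1 + ‖w z‖) / (1 + ε) = 1 / (1 + ε) + 1 / (1 + ε) * ‖w z‖ := by ring
      _ ≤ _ := by linarith
  have h1w' : ∀ z ∈ Metric.closedBall (0:ℂ) 1, 1 ≤ ‖1 + w z‖ := by
    intro z hz
    refine le_trans ?_ (Complex.re_le_norm _)
    have h2 : 0 ≤ 1 / (1 + ε) * ‖w z‖ := by positivity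
    have := hwre z hz
    rw [Complex.add_re, Complex.one_re]
    linarith
  have hne : ∀ z ∈ Metric.closedBall (0:ℂ) 1, 1 + w z ≠ 0 := fun z hz h => by
    have := h1w' z hz
    rw [h, norm_zero] at this
    linarith
  have hq1 : ∀ z ∈ Metric.closedBall (0:ℂ) 1, 1 - w z / (1 + w z) = 1 / (1 + w z) := fun z hz => by
    have := hne z hz
    field_simp
    ring
  have hwd : DiffContOnCl ℂ w (Metric.ball 0 1) := by
    constructor
    · intro z hz
      exact (hHd.differentiableOn z hz).cpow (differentiableWithinAt_const _)
        (Or.inl (hHre z (ball_subset_closedBall hz)))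
    · intro z hz
      refine (hHd.continuousOn z hz).cpow continuousWithinAt_const ?_
      rw [closure_ball _ one_ne_zero] at hz
      exact Or.inl (hHre z hz)
  refine ⟨fun z => w z / (1 + w z), ?_, ?_, ?_, ?_⟩
  · constructor
    · exact hwd.differentiableOn.div (hwd.differentiableOn.const_add _)
        fun z hz => hne z (ball_subset_closedBall hz)
    · refine hwd.continuousOn.div (continuousOn_const.add hwd.continuousOn) fun z hz => ?_
      rw [closure_ball _ one_ne_zero] at hz
      exact hne z hz
  · intro z hz
    have hpos := zero_lt_one.trans_le (h1w' z hz)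
    have h3 := h1w z hz
    rw [hq1 z hz, norm_div, norm_div, norm_one, ← add_div, div_le_iff₀ hpos]
    rw [div_le_iff₀ (by positivity)] at h3
    linarith
  · intro z hz
    have hzc := sphere_subset_closedBall (hKs hz)
    have h4 : 1 + 1 / ε ≤ ‖w z‖ := by
      rw [hwn z hzc]
      calc 1 + 1 / ε = ((1 + 1 / ε) ^ (1 / α)) ^ α := by
            rw [← Real.rpow_mul (by positivity), one_div_mul_cancel hα0.ne', Real.rpow_one]
        _ ≤ _ := Real.rpow_le_rpow (by positivity) (hHK z hz) hα0.le
    have h5 : 1 / ε ≤ ‖1 + w z‖ := by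
      have := norm_sub_norm_le (w z) (-1)
      rw [sub_neg_eq_add, norm_neg, norm_one, add_comm (w z)] at this
      linarith
    rw [hq1 z hzc, norm_div, norm_one]
    exact (one_div_le (by have := h1w' z hzc; linarith) hε).mpr h5
  · intro z hz
    have hzc := hK' hz
    have h4 : ‖w z‖ ≤ ε := by
      rw [hwn z hzc]
      calc ‖H z‖ ^ α ≤ (ε ^ (1 / α)) ^ α := Real.rpow_le_rpow (norm_nonneg _) (hHK' z hz) hα0.le
        _ = ε := by
            rw [← Real.rpow_mul (by positivity), one_div_mul_cancel hα0.ne', Real.rpow_one]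
    rw [norm_div]
    exact (div_le_self (norm_nonneg _) (h1w' z hzc)).trans h4

/-- Prescribing an approximate constant value on a null compact subset of the circle, without
leaving the unit ball and almost without changing the function on a disjoint compact set. -/
lemma exists_modification {P K' : Set ℂ} (hPc : IsCompact P)
    (hPs : P ⊆ Metric.sphere (0:ℂ) 1) (hP : (μH[1] : Measure ℂ) P = 0)
    (hK'c : IsCompact K') (hK' : K' ⊆ Metric.closedBall (0:ℂ) 1) (hdis : Disjoint P K')
    {f : ℂ → ℂ} (hf : DiffContOnCl ℂ f (Metric.ball 0 1))
    (hf1 : ∀ z ∈ Metric.closedBall (0:ℂ) 1, ‖f z‖ ≤ 1) {c : ℂ} (hc : ‖c‖ ≤ 1)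
    {ε : ℝ} (hε : 0 < ε) :
    ∃ g : ℂ → ℂ, DiffContOnCl ℂ g (Metric.ball 0 1) ∧
      (∀ z ∈ Metric.closedBall (0:ℂ) 1, ‖g z‖ ≤ 1) ∧
      (∀ z ∈ P, ‖g z - c‖ ≤ ε) ∧ ∀ z ∈ K', ‖g z - f z‖ ≤ ε := by
  have hη : 0 < ε / 3 := by positivity
  obtain ⟨q, hq, hq1, hqP, hqK⟩ := exists_bump hPc hPs hP hK'c hK' hdis hη
  set η := ε / 3 with hηdef
  have hη1 : ((1 + η : ℝ) : ℂ) ≠ 0 := by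
    rw [Complex.ofReal_ne_zero]; positivity
  have hn : ‖((1 + η : ℝ) : ℂ)‖ = 1 + η := by
    rw [Complex.norm_real, Real.norm_of_nonneg (by positivity)]
  let g : ℂ → ℂ := fun z => ((1 + η : ℝ) : ℂ)⁻¹ * ((1 - q z) * f z + q z * c)
  have hclose : ∀ z a, ‖(1 - q z) * f z + q z * c - ((1 + η : ℝ) : ℂ) * a‖ ≤ ε →
      ‖g z - a‖ ≤ ε := by
    intro z a h
    have e : g z - a =
        ((1 + η : ℝ) : ℂ)⁻¹ * ((1 - q z) * f z + q z * c - ((1 + η : ℝ) : ℂ) * a) := by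
      simp only [g]
      field_simp
    rw [e, norm_mul, norm_inv, hn]
    refine (mul_le_of_le_one_left (norm_nonneg _) ?_).trans h
    exact inv_le_one_of_one_le₀ (by linarith)
  refine ⟨g, ?_, ?_, ?_, ?_⟩
  · have h1 : DiffContOnCl ℂ (fun z => (1 - q z) * f z + q z * c) (Metric.ball 0 1) := by
      constructor
      · exact ((hq.differentiableOn.const_sub _).mul hf.differentiableOn).add
          (hq.differentiableOn.mul_const _)
      · exact ((continuousOn_const.sub hq.continuousOn).mul hf.continuousOn).add
          (hq.continuousOn.mul continuousOn_const)
    exact h1.const_smul ((1 + η : ℝ) : ℂ)⁻¹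
  · intro z hz
    have h2 : ‖(1 - q z) * f z + q z * c‖ ≤ 1 + η := by
      refine (norm_add_le _ _).trans ?_
      rw [norm_mul, norm_mul]
      have h3 := mul_le_of_le_one_right (norm_nonneg (1 - q z)) (hf1 z hz)
      have h4 := mul_le_of_le_one_right (norm_nonneg (q z)) hc
      linarith [hq1 z hz]
    simp only [g]
    rw [norm_mul, norm_inv, hn, inv_mul_le_iff₀ (by positivity), mul_one]
    exact h2
  · intro z hz
    apply hclose
    have e : (1 - q z) * f z + q z * c - ((1 + η : ℝ) : ℂ) * c =
        (1 - q z) * (f z - c) - (η : ℂ) * c := by push_cast; ring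
    have hfz := hf1 z (sphere_subset_closedBall (hPs hz))
    rw [e]
    refine (norm_sub_le _ _).trans ?_
    rw [norm_mul, norm_mul, Complex.norm_real, Real.norm_of_nonneg hη.le]
    have h3 : ‖f z - c‖ ≤ 2 := (norm_sub_le _ _).trans (by linarith)
    have h4 := mul_le_mul (hqP z hz) h3 (norm_nonneg _) hη.le
    have h5 := mul_le_of_le_one_right hη.le hc
    linarith
  · intro z hz
    apply hclose
    have e : (1 - q z) * f z + q z * c - ((1 + η : ℝ) : ℂ) * f z =
        q z * (c - f z) - (η : ℂ) * f z := by push_cast; ring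
    have hfz := hf1 z (hK' hz)
    rw [e]
    refine (norm_sub_le _ _).trans ?_
    rw [norm_mul, norm_mul, Complex.norm_real, Real.norm_of_nonneg hη.le]
    have h3 : ‖c - f z‖ ≤ 2 := (norm_sub_le _ _).trans (by linarith)
    have h4 := mul_le_mul (hqK z hz) h3 (norm_nonneg _) hη.le
    have h5 := mul_le_of_le_one_right hη.le hfz
    linarith

/-- A function in the unit ball of the disc algebra can be approximated on a compact subset of the
disc by one that approximates a given continuous function on a null compact subset of the circle. -/
lemma exists_simultaneous_approx {K L : Set ℂ} (hKc : IsCompact K)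
    (hKs : K ⊆ Metric.sphere (0:ℂ) 1) (hK : (μH[1] : Measure ℂ) K = 0)
    (hLc : IsCompact L) (hL : L ⊆ Metric.ball (0:ℂ) 1)
    {G : ℂ → ℂ} (hG : DiffContOnCl ℂ G (Metric.ball 0 1))
    (hG1 : ∀ z ∈ Metric.closedBall (0:ℂ) 1, ‖G z‖ ≤ 1)
    (φ : C(K, ℂ)) (hφ : ∀ z, ‖φ z‖ ≤ 1) {ε : ℝ} (hε : 0 < ε) :
    ∃ f : ℂ → ℂ, DiffContOnCl ℂ f (Metric.ball 0 1) ∧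
      (∀ z ∈ Metric.closedBall (0:ℂ) 1, ‖f z‖ ≤ 1) ∧
      (∀ z : K, ‖f z - φ z‖ ≤ ε) ∧ ∀ z ∈ L, ‖f z - G z‖ ≤ ε := by
  classical
  have : CompactSpace K := isCompact_iff_compactSpace.mp hKc
  have : TotallyDisconnectedSpace K :=
    totallyDisconnectedSpace_subtype_iff.mpr (isTotallyDisconnected_of_hausdorffMeasure_one hK)
  have hV : ∀ x : K, ∃ V : Set K, IsClopen V ∧ x ∈ V ∧ ∀ y ∈ V, ‖φ x - φ y‖ ≤ ε / 2 := by
    intro x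
    obtain ⟨V, hVc, hxV, hVs⟩ := compact_exists_isClopen_in_isOpen
      (isOpen_ball.preimage φ.continuous : IsOpen (φ ⁻¹' Metric.ball (φ x) (ε / 2)))
      (by simpa using hε : x ∈ φ ⁻¹' Metric.ball (φ x) (ε / 2))
    refine ⟨V, hVc, hxV, fun y hy => ?_⟩
    have := mem_ball.mp (hVs hy)
    rw [dist_comm, dist_eq_norm] at this
    exact this.le
  choose V hVc hxV hVφ using hV
  obtain ⟨T, hT⟩ := isCompact_univ.elim_finite_subcover V (fun x => (hVc x).isOpen)
    (fun x _ => mem_iUnion.mpr ⟨x, hxV x⟩)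
  have key : ∀ S : Finset K, ∀ η > 0, ∃ f : ℂ → ℂ, DiffContOnCl ℂ f (Metric.ball 0 1) ∧
      (∀ z ∈ Metric.closedBall (0:ℂ) 1, ‖f z‖ ≤ 1) ∧
      (∀ x ∈ S, ∀ y ∈ V x, ‖f y - φ y‖ ≤ ε / 2 + η) ∧ ∀ z ∈ L, ‖f z - G z‖ ≤ η := by
    intro S
    induction S using Finset.induction_on with
    | empty => exact fun η hη => ⟨G, hG, hG1, by simp, fun z _ => by simpa using hη.le⟩
    | insert x S hx ih =>
      intro η hη
      obtain ⟨f, hf, hf1, hfS, hfL⟩ := ih (η / 2) (half_pos hη)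
      have hW : IsClosed ((⋃ y ∈ S, V y) \ V x) :=
        (isClosed_biUnion_finset fun y _ => (hVc y).isClosed).sdiff (hVc x).isOpen
      obtain ⟨g, hg, hg1, hgP, hgK⟩ := exists_modification
        (P := Subtype.val '' V x) (K' := L ∪ Subtype.val '' ((⋃ y ∈ S, V y) \ V x))
        ((hVc x).isClosed.isCompact.image continuous_subtype_val)
        (by rintro _ ⟨y, -, rfl⟩; exact hKs y.2)
        (measure_mono_null (by rintro _ ⟨y, -, rfl⟩; exact y.2) hK)
        (hLc.union (hW.isCompact.image continuous_subtype_val))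
        (union_subset (hL.trans ball_subset_closedBall)
          (by rintro _ ⟨y, -, rfl⟩; exact sphere_subset_closedBall (hKs y.2)))
        (by
          rw [Set.disjoint_left]
          rintro _ ⟨y, hy, rfl⟩ (h | ⟨y', hy', h⟩)
          · have h1 := hL h
            have h2 := hKs y.2
            rw [mem_ball] at h1
            rw [mem_sphere] at h2
            linarith
          · exact hy'.2 (Subtype.ext h ▸ hy))
        hf hf1 (hφ x) (half_pos hη)
      refine ⟨g, hg, hg1, ?_, fun z hz => ?_⟩
      · intro x' hx' y hy
        by_cases hyx : y ∈ V x
        · have h1 := hgP y (mem_image_of_mem _ hyx)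
          have h2 := norm_add_le (g y - φ x) (φ x - φ y)
          rw [sub_add_sub_cancel] at h2
          linarith [hVφ x y hyx]
        · have hx'S : x' ∈ S := by
            refine (Finset.mem_insert.mp hx').resolve_left ?_
            rintro rfl
            exact hyx hy
          have h1 := hgK y (Or.inr (mem_image_of_mem _ ⟨mem_biUnion hx'S hy, hyx⟩))
          have h2 := norm_add_le (g y - f y) (f y - φ y)
          rw [sub_add_sub_cancel] at h2
          linarith [hfS x' hx'S y hy]
      · have h1 := hgK z (Or.inl hz)
        have h2 := norm_add_le (g z - f z) (f z - G z)
        rw [sub_add_sub_cancel] at h2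
        linarith [hfL z hz]
  obtain ⟨f, hf, hf1, hfT, hfL⟩ := key T (ε / 2) (half_pos hε)
  refine ⟨f, hf, hf1, fun z => ?_, fun z hz => (hfL z hz).trans (half_le_self hε.le)⟩
  obtain ⟨x, hx, hzx⟩ := mem_iUnion₂.mp (hT (mem_univ z))
  have := hfT x hx z hzx
  linarith

lemma isClosed_HinftyBall : IsClosed HinftyBall := by
  refine isClosed_iff_forall_filter.mpr fun f F hF hFB hFf => ?_
  have hT := UniformOnFun.tendsto_iff_tendstoUniformlyOn.mp (tendsto_id'.mpr hFf)
  have hB : ∀ᶠ g in F, g ∈ HinftyBall := le_principal_iff.mp hFB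
  constructor
  · refine TendstoLocallyUniformlyOn.differentiableOn (φ := F)
      ((tendstoLocallyUniformlyOn_iff_forall_isCompact isOpen_ball).mpr
        fun L hL hLc => hT L ⟨hL, hLc⟩) ?_ isOpen_ball
    filter_upwards [hB] with g hg using hg.1
  · intro z hz
    have h1 := (hT {z} ⟨singleton_subset_iff.mpr hz, isCompact_singleton⟩).tendsto_at
      (mem_singleton z)
    refine le_of_tendsto h1.norm ?_
    filter_upwards [hB] with g hg using hg.2 z hz

instance : BaireSpace ↥HinftyBall := by
  have : CompleteSpace ↥HinftyBall := isClosed_HinftyBall.completeSpace_coe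
  have hmono : Monotone fun n : ℕ => Metric.closedBall (0:ℂ) (1 - 1 / ((n : ℝ) + 1)) := by
    intro m n hmn
    refine closedBall_subset_closedBall (sub_le_sub_left ?_ _)
    exact Nat.one_div_le_one_div hmn
  have : (uniformity (UniformOnFun ℂ ℂ discCompacts)).IsCountablyGenerated := by
    refine UniformOnFun.isCountablyGenerated_uniformity discCompacts
      (t := fun n : ℕ => Metric.closedBall (0:ℂ) (1 - 1 / ((n : ℝ) + 1)))
      (fun n => ⟨closedBall_subset_ball (sub_lt_self _ Nat.one_div_pos_of_nat),
        isCompact_closedBall _ _⟩) hmono ?_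
    rintro L ⟨hL, hLc⟩
    obtain ⟨R, hR, hLR⟩ := exists_lt_subset_ball hLc.isClosed hL
    obtain ⟨n, hn⟩ := exists_nat_one_div_lt (sub_pos.mpr hR)
    exact ⟨n, hLR.trans (ball_subset_closedBall.trans (closedBall_subset_closedBall (by linarith)))⟩
  have : (uniformity ↥HinftyBall).IsCountablyGenerated := by
    rw [uniformity_subtype]; infer_instance
  let := UniformSpace.pseudoMetricSpace ↥HinftyBall
  infer_instance

/-- The functions of the unit ball one of whose dilates, with ratio at distance less than
`1 / (n + 1)` from `1`, is uniformly at distance less than `1 / (n + 1)` from `φ` on `K`. -/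
def radialApprox (K : Set ℂ) (φ : C(K, ℂ)) (n : ℕ) : Set ↥HinftyBall :=
  {f | ∃ r ∈ Set.Ioo (1 - 1 / ((n : ℝ) + 1)) 1, ∃ δ < 1 / ((n : ℝ) + 1),
    ∀ z : K, ‖UniformOnFun.toFun discCompacts f.1 ((r : ℂ) * z) - φ z‖ ≤ δ}

lemma pos_of_mem_Ioo_one_sub {n : ℕ} {r : ℝ} (hr : r ∈ Set.Ioo (1 - 1 / ((n : ℝ) + 1)) 1) :
    0 < r := by
  have : 1 / ((n : ℝ) + 1) ≤ 1 := by
    rw [div_le_one (by positivity)]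
    linarith [(Nat.cast_nonneg n : (0 : ℝ) ≤ n)]
  linarith [hr.1]

lemma norm_mul_lt_one {K : Set ℂ} (hKs : K ⊆ Metric.sphere (0:ℂ) 1) {r : ℝ} (h0 : 0 < r)
    (h1 : r < 1) {z : ℂ} (hz : z ∈ K) : (r : ℂ) * z ∈ Metric.ball (0:ℂ) 1 := by
  have hz1 : ‖z‖ = 1 := by simpa using hKs hz
  rwa [mem_ball_zero_iff, norm_mul, hz1, mul_one, Complex.norm_real, Real.norm_of_nonneg h0.le]

lemma isOpen_radialApprox {K : Set ℂ} (hKc : IsCompact K) (hKs : K ⊆ Metric.sphere (0:ℂ) 1)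
    (φ : C(K, ℂ)) (n : ℕ) : IsOpen (radialApprox K φ n) := by
  rw [isOpen_iff_mem_nhds]
  rintro f ⟨r, hr, δ, hδ, hf⟩
  have hr0 := pos_of_mem_Ioo_one_sub hr
  have hmem : (fun z => (r : ℂ) * z) '' K ∈ discCompacts :=
    ⟨by rintro _ ⟨z, hz, rfl⟩; exact norm_mul_lt_one hKs hr0 hr.2 hz,
      hKc.image (by fun_prop)⟩
  have hη : 0 < (1 / ((n : ℝ) + 1) - δ) / 2 := by linarith
  have hU := UniformOnFun.gen_mem_nhds ℂ discCompacts f.1 hmem (dist_mem_uniformity hη)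
  filter_upwards [continuous_subtype_val.continuousAt.preimage_mem_nhds hU] with g hg
  refine ⟨r, hr, δ + (1 / ((n : ℝ) + 1) - δ) / 2, by linarith, fun z => ?_⟩
  have h1 := hg _ (mem_image_of_mem _ z.2)
  simp only [dist_eq_norm] at h1
  rw [norm_sub_rev] at h1
  have h2 := norm_add_le
    (UniformOnFun.toFun discCompacts g.1 ((r : ℂ) * z) -
      UniformOnFun.toFun discCompacts f.1 ((r : ℂ) * z))
    (UniformOnFun.toFun discCompacts f.1 ((r : ℂ) * z) - φ z)
  rw [sub_add_sub_cancel] at h2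
  linarith [hf z]

/-- Functions of the unit ball are approximated on compact subsets of the disc by functions of
the unit ball of the disc algebra. -/
lemma exists_discAlgebra_approx {g : ℂ → ℂ} (hg : DifferentiableOn ℂ g (Metric.ball 0 1))
    (hg1 : ∀ z ∈ Metric.ball (0:ℂ) 1, ‖g z‖ ≤ 1) {L : Set ℂ} (hLc : IsCompact L)
    (hL : L ⊆ Metric.ball (0:ℂ) 1) {ε : ℝ} (hε : 0 < ε) :
    ∃ G : ℂ → ℂ, DiffContOnCl ℂ G (Metric.ball 0 1) ∧
      (∀ z ∈ Metric.closedBall (0:ℂ) 1, ‖G z‖ ≤ 1) ∧ ∀ z ∈ L, ‖G z - g z‖ ≤ ε := by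
  obtain ⟨R, hR, hLR⟩ := exists_lt_subset_ball hLc.isClosed hL
  have huc : UniformContinuousOn g (Metric.closedBall 0 R) :=
    (isCompact_closedBall _ _).uniformContinuousOn_of_continuous
      (hg.continuousOn.mono (closedBall_subset_ball hR))
  obtain ⟨δ, hδ, huc⟩ := Metric.uniformContinuousOn_iff.mp huc ε hε
  obtain ⟨ρ, hρδ, hρ1⟩ := exists_between (max_lt (sub_lt_self (1:ℝ) hδ) zero_lt_one)
  have hρ0 : 0 < ρ := (le_max_right _ _).trans_lt hρδ
  have hρ2 : 1 - δ < ρ := (le_max_left _ _).trans_lt hρδ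
  have hnorm : ∀ z : ℂ, ‖(ρ : ℂ) * z‖ = ρ * ‖z‖ := fun z => by
    rw [norm_mul, Complex.norm_real, Real.norm_of_nonneg hρ0.le]
  have hmaps : ∀ z ∈ Metric.closedBall (0:ℂ) 1, (ρ : ℂ) * z ∈ Metric.ball (0:ℂ) 1 := by
    intro z hz
    rw [mem_closedBall_zero_iff] at hz
    rw [mem_ball_zero_iff, hnorm]
    exact (mul_le_of_le_one_right hρ0.le hz).trans_lt hρ1
  refine ⟨fun z => g ((ρ : ℂ) * z), ?_, fun z hz => hg1 _ (hmaps z hz), fun z hz => ?_⟩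
  · refine DifferentiableOn.diffContOnCl ?_
    rw [closure_ball _ one_ne_zero]
    exact hg.comp (by fun_prop) hmaps
  · have hzR : ‖z‖ < R := by simpa using hLR hz
    have hz1 : ‖z‖ < 1 := by simpa using hL hz
    rw [← dist_eq_norm]
    refine (huc _ ?_ _ ?_ ?_).le
    · rw [mem_closedBall_zero_iff, hnorm]
      exact (mul_le_of_le_one_left (norm_nonneg _) hρ1.le).trans hzR.le
    · rw [mem_closedBall_zero_iff]; exact hzR.le
    · have e : (ρ : ℂ) * z - z = ((ρ - 1 : ℝ) : ℂ) * z := by push_cast; ring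
      rw [dist_eq_norm, e, norm_mul, Complex.norm_real, Real.norm_of_nonpos (by linarith)]
      refine (mul_le_of_le_one_right (by linarith) hz1.le).trans_lt ?_
      linarith

lemma dense_radialApprox {K : Set ℂ} (hKc : IsCompact K)
    (hKs : K ⊆ Metric.sphere (0:ℂ) 1) (hK : (μH[1] : Measure ℂ) K = 0)
    (φ : C(K, ℂ)) (hφ : ∀ z, ‖φ z‖ ≤ 1) (n : ℕ) : Dense (radialApprox K φ n) := by
  intro g
  have hne : discCompacts.Nonempty := ⟨∅, empty_subset _, isCompact_empty⟩
  have hdir : DirectedOn (· ⊆ ·) discCompacts := fun A hA B hB =>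
    ⟨A ∪ B, ⟨union_subset hA.1 hB.1, hA.2.union hB.2⟩, subset_union_left, subset_union_right⟩
  have hbasis := (UniformOnFun.hasBasis_nhds_of_basis ℂ ℂ discCompacts g.1 hne hdir
    Metric.uniformity_basis_dist).comap (Subtype.val : ↥HinftyBall → _)
  rw [← nhds_induced Subtype.val g] at hbasis
  rw [mem_closure_iff_nhds_basis hbasis]
  rintro ⟨L, ε⟩ ⟨hL, hε⟩
  simp only at hL hε
  have hε3 : 0 < ε / 3 := by positivity
  obtain ⟨G, hG, hG1, hGg⟩ := exists_discAlgebra_approx g.2.1 g.2.2 hL.2 hL.1 hε3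
  have hη : 0 < min (ε / 3) (1 / ((n : ℝ) + 1) / 3) := by positivity
  obtain ⟨f, hf, hf1, hfK, hfL⟩ := exists_simultaneous_approx hKc hKs hK hL.2 hL.1 hG hG1 φ hφ hη
  refine ⟨⟨UniformOnFun.ofFun discCompacts f, hf.differentiableOn,
    fun z hz => hf1 z (ball_subset_closedBall hz)⟩, ?_, ?_⟩
  · have huc : UniformContinuousOn f (Metric.closedBall 0 1) :=
      (isCompact_closedBall _ _).uniformContinuousOn_of_continuous
        (by simpa [closure_ball] using hf.continuousOn)
    have hn3 : 0 < 1 / ((n : ℝ) + 1) / 3 := by positivity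
    obtain ⟨δ, hδ, huc⟩ := Metric.uniformContinuousOn_iff.mp huc _ hn3
    obtain ⟨r, hr, hr1⟩ := exists_between (max_lt (sub_lt_self (1:ℝ) hδ)
      (sub_lt_self (1:ℝ) (show 0 < 1 / ((n : ℝ) + 1) by positivity)))
    have hrI : r ∈ Set.Ioo (1 - 1 / ((n : ℝ) + 1)) 1 := ⟨(le_max_right _ _).trans_lt hr, hr1⟩
    have hrδ : 1 - δ < r := (le_max_left _ _).trans_lt hr
    refine ⟨r, hrI, 2 * (1 / ((n : ℝ) + 1) / 3), by linarith, fun z => ?_⟩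
    have hz1 : ‖(z : ℂ)‖ = 1 := by simpa using hKs z.2
    have h1 : dist (f ((r : ℂ) * z)) (f z) < 1 / ((n : ℝ) + 1) / 3 := by
      refine huc _ (ball_subset_closedBall (norm_mul_lt_one hKs (pos_of_mem_Ioo_one_sub hrI) hr1 z.2))
        _ (sphere_subset_closedBall (hKs z.2)) ?_
      have e : (r : ℂ) * z - z = ((r - 1 : ℝ) : ℂ) * z := by push_cast; ring
      rw [dist_eq_norm, e, norm_mul, Complex.norm_real, Real.norm_of_nonpos (by linarith), hz1]
      linarith
    rw [dist_eq_norm] at h1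
    have h2 := norm_add_le (f ((r : ℂ) * z) - f z) (f z - φ z)
    rw [sub_add_sub_cancel] at h2
    have h3 := (hfK z).trans (min_le_right _ _)
    rw [UniformOnFun.toFun_ofFun]
    linarith
  · intro z hz
    have h1 := (hfL z hz).trans (min_le_left _ _)
    have h2 := norm_add_le (f z - G z) (G z - UniformOnFun.toFun discCompacts g.1 z)
    rw [sub_add_sub_cancel] at h2
    have h3 := hGg z hz
    change dist (f z) (UniformOnFun.toFun discCompacts g.1 z) < ε
    rw [dist_eq_norm]
    linarith

lemma univClass_eq_iInter {K : Set ℂ} (hKs : K ⊆ Metric.sphere (0:ℂ) 1) [CompactSpace K]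
    {d : ℕ → Metric.closedBall (0 : C(K, ℂ)) 1} (hd : DenseRange d) :
    UnivClass K = ⋂ k, ⋂ n, radialApprox K (d k).1 n := by
  have hball : ∀ φ : Metric.closedBall (0 : C(K, ℂ)) 1, ∀ z, ‖φ.1 z‖ ≤ 1 := fun φ z =>
    (φ.1.norm_coe_le_norm z).trans (mem_closedBall_zero_iff.mp φ.2)
  ext f
  simp only [mem_iInter]
  constructor
  · intro hf k n
    classical
    let φ : ℂ → ℂ := fun z => if h : z ∈ K then (d k).1 ⟨z, h⟩ else 0
    have hφ : ∀ z : K, φ z = (d k).1 z := fun z => dif_pos z.2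
    have hφ1 : ∀ z ∈ K, ‖φ z‖ ≤ 1 := fun z hz => by
      rw [hφ ⟨z, hz⟩]; exact hball _ _
    have hφc : ContinuousOn φ K := by
      rw [continuousOn_iff_continuous_domRestrict]
      convert (d k).1.continuous using 1
      exact funext hφ
    obtain ⟨r, hr, hr1, hlim⟩ := hf φ hφc hφ1
    have hpos : 0 < 1 / ((n : ℝ) + 1) := by positivity
    obtain ⟨m, hm1, hm2⟩ := ((hr1.eventually (lt_mem_nhds (sub_lt_self 1 hpos))).and
      (hlim.eventually (gt_mem_nhds hpos))).exists
    refine ⟨r m, ⟨hm1, (hr m).2⟩, _, hm2, fun z => ?_⟩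
    have hbdd : ∀ w ∈ K, ‖UniformOnFun.toFun discCompacts f.1 ((r m : ℂ) * w) - φ w‖ ≤ 2 := by
      intro w hw
      refine (norm_sub_le _ _).trans ?_
      linarith [f.2.2 _ (norm_mul_lt_one hKs (hr m).1 (hr m).2 hw), hφ1 w hw]
    rw [← hφ z]
    refine le_trans (le_of_eq ?_) (le_ciSup (f := fun w : ℂ => ⨆ _ : w ∈ K,
      ‖UniformOnFun.toFun discCompacts f.1 ((r m : ℂ) * w) - φ w‖) ⟨2, ?_⟩ (z : ℂ))
    · exact (ciSup_pos (f := fun _ : (z : ℂ) ∈ K =>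
        ‖UniformOnFun.toFun discCompacts f.1 ((r m : ℂ) * z) - φ z‖) z.2).symm
    · rintro _ ⟨w, rfl⟩
      exact Real.iSup_le (hbdd w) zero_le_two
  · intro hf φ hφc hφ1
    let ψ : C(K, ℂ) := ⟨K.domRestrict φ, hφc.domRestrict⟩
    have hψ : ψ ∈ Metric.closedBall (0 : C(K, ℂ)) 1 := by
      rw [mem_closedBall_zero_iff, ContinuousMap.norm_le _ zero_le_one]
      exact fun z => hφ1 z z.2
    have hex : ∀ n : ℕ, ∃ r ∈ Set.Ioo (1 - 1 / ((n : ℝ) + 1)) 1, ∀ z ∈ K,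
        ‖UniformOnFun.toFun discCompacts f.1 ((r : ℂ) * z) - φ z‖ ≤ 2 * (1 / ((n : ℝ) + 1)) := by
      intro n
      obtain ⟨k, hk⟩ := hd.exists_dist_lt ⟨ψ, hψ⟩ (show 0 < 1 / ((n : ℝ) + 1) by positivity)
      obtain ⟨r, hr, δ, hδ, hfr⟩ := hf k n
      refine ⟨r, hr, fun z hz => ?_⟩
      have h1 := hfr ⟨z, hz⟩
      have h2 : ‖φ z - (d k).1 ⟨z, hz⟩‖ ≤ dist ψ (d k).1 := by
        rw [← dist_eq_norm]
        exact ContinuousMap.dist_apply_le_dist (f := ψ) (g := (d k).1) ⟨z, hz⟩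
      have h3 : dist ψ (d k).1 < 1 / ((n : ℝ) + 1) := hk
      have h4 := norm_sub_le
        (UniformOnFun.toFun discCompacts f.1 ((r : ℂ) * z) - (d k).1 ⟨z, hz⟩)
        (φ z - (d k).1 ⟨z, hz⟩)
      rw [sub_sub_sub_cancel_right] at h4
      linarith
    choose r hr hfr using hex
    have hlim : Tendsto (fun n : ℕ => 1 / ((n : ℝ) + 1)) atTop (nhds 0) :=
      tendsto_one_div_add_atTop_nhds_zero_nat
    refine ⟨r, fun n => ⟨pos_of_mem_Ioo_one_sub (hr n), (hr n).2⟩, ?_, ?_⟩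
    · refine tendsto_of_tendsto_of_tendsto_of_le_of_le ?_ tendsto_const_nhds
        (fun n => (hr n).1.le) fun n => (hr n).2.le
      simpa using hlim.const_sub 1
    · refine squeeze_zero (g := fun n : ℕ => 2 * (1 / ((n : ℝ) + 1))) (fun n => ?_) (fun n => ?_) ?_
      · exact Real.iSup_nonneg fun z => Real.iSup_nonneg fun _ => norm_nonneg _
      · exact Real.iSup_le (fun z => Real.iSup_le (hfr n z) (by positivity)) (by positivity)
      · simpa using hlim.const_mul 2

/-- For `K ⊆ 𝕋` compact of arclength measure 0, the class `𝒰_K` is a dense `G_δ` subset of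
the closed unit ball of `H^∞` with the topology of locally uniform convergence. -/
theorem univClass_denseGδ (K : Set ℂ) (hKc : IsCompact K)
    (hKs : K ⊆ Metric.sphere (0:ℂ) 1) (hK0 : arclength K = 0) :
    IsGδ (UnivClass K) ∧ Dense (UnivClass K) := by
  have : CompactSpace K := isCompact_iff_compactSpace.mp hKc
  have : Nonempty (Metric.closedBall (0 : C(K, ℂ)) 1) := ⟨⟨0, mem_closedBall_self zero_le_one⟩⟩
  have hK := hausdorffMeasure_one_eq_zero_of_arclength hKc hKs hK0
  have hopen := fun (φ : C(K, ℂ)) n => isOpen_radialApprox hKc hKs φ n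
  rw [univClass_eq_iInter hKs
    (TopologicalSpace.denseRange_denseSeq (Metric.closedBall (0 : C(K, ℂ)) 1))]
  refine ⟨.iInter fun k => .iInter fun n => (hopen _ n).isGδ, ?_⟩
  refine dense_iInter_of_Gδ (fun k => .iInter fun n => (hopen _ n).isGδ) fun k => ?_
  refine dense_iInter_of_isOpen (fun n => hopen _ n) fun n => ?_
  refine dense_radialApprox hKc hKs hK _ (fun z => ?_) n
  exact (ContinuousMap.norm_coe_le_norm _ z).trans (mem_closedBall_zero_iff.mp (Subtype.prop _))
end
end

section
/- Let K be a compact subset of the unit circle of arclength measure 0. Then there exists an infinite Blaschke product B such that for every continuous φ : K → ℂ with sup_K |φ| ≤ 1 there exists a sequence (r_n) in (0,1) converging to 1 with sup_{z∈K} |B(r_n z) − φ(z)| → 0. -/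
open Complex Metric MeasureTheory Filter Set

noncomputable section

/-- An infinite Blaschke product: a convergent infinite product of rotated disc automorphisms
whose zeros satisfy the Blaschke condition. -/
def IsInfiniteBlaschke (B : ℂ → ℂ) : Prop :=
  ∃ (ζ : ℕ → ℂ) (w : ℕ → ℂ), (∀ k, ‖ζ k‖ = 1) ∧ (∀ k, ‖w k‖ < 1) ∧
    Summable (fun k => 1 - ‖w k‖) ∧
    ∀ z ∈ Metric.ball (0:ℂ) 1,
      Tendsto (fun n => ∏ k ∈ Finset.range n,
          ζ k * (z - w k) / (1 - (starRingEnd ℂ) (w k) * z)) atTop (nhds (B z))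

/-- The disc automorphism vanishing at `a ≠ 0`, rotated so that its value at `0` is `‖a‖ > 0`. -/
def blaschkeFactor (a z : ℂ) : ℂ :=
  (-(‖a‖ : ℂ) / a) * (z - a) / (1 - (starRingEnd ℂ) a * z)

lemma one_sub_conj_mul_ne_zero {a z : ℂ} (ha : ‖a‖ < 1) (hz : ‖z‖ ≤ 1) :
    1 - (starRingEnd ℂ) a * z ≠ 0 := by
  intro h
  have h1 : ‖(starRingEnd ℂ) a * z‖ = 1 := by rw [← sub_eq_zero.1 h]; simp
  rw [norm_mul, RCLike.norm_conj] at h1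
  nlinarith [norm_nonneg a, norm_nonneg z]

lemma norm_sub_le_norm_one_sub_conj_mul {a z : ℂ} (ha : ‖a‖ < 1) (hz : ‖z‖ ≤ 1) :
    ‖z - a‖ ≤ ‖1 - (starRingEnd ℂ) a * z‖ := by
  have key : ‖1 - (starRingEnd ℂ) a * z‖ ^ 2 - ‖z - a‖ ^ 2 = (1 - ‖a‖ ^ 2) * (1 - ‖z‖ ^ 2) := by
    simp only [Complex.sq_norm, Complex.normSq_apply, Complex.sub_re, Complex.sub_im,
      Complex.mul_re, Complex.mul_im, Complex.conj_re, Complex.conj_im, Complex.one_re,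
      Complex.one_im]
    ring
  have h1 : 0 ≤ (1 - ‖a‖ ^ 2) * (1 - ‖z‖ ^ 2) :=
    mul_nonneg (by nlinarith [norm_nonneg a]) (by nlinarith [norm_nonneg z])
  exact le_of_sq_le_sq (by linarith) (norm_nonneg _)

lemma norm_blaschkeFactor_le_one {a z : ℂ} (ha : ‖a‖ < 1) (hz : ‖z‖ ≤ 1) :
    ‖blaschkeFactor a z‖ ≤ 1 := by
  have h0 : 0 < ‖1 - (starRingEnd ℂ) a * z‖ := norm_pos_iff.2 (one_sub_conj_mul_ne_zero ha hz)
  rw [blaschkeFactor, norm_div, norm_mul, div_le_one h0]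
  refine le_trans ?_ (norm_sub_le_norm_one_sub_conj_mul ha hz)
  refine mul_le_of_le_one_left (norm_nonneg _) ?_
  rw [norm_div, norm_neg, Complex.norm_real, norm_norm]
  exact div_self_le_one _

lemma norm_blaschkeFactor_eq_one {a z : ℂ} (ha0 : a ≠ 0) (ha : ‖a‖ < 1) (hz : ‖z‖ = 1) :
    ‖blaschkeFactor a z‖ = 1 := by
  have h0 : 0 < ‖1 - (starRingEnd ℂ) a * z‖ := norm_pos_iff.2 (one_sub_conj_mul_ne_zero ha hz.le)
  have hzz : (starRingEnd ℂ) z * z = 1 := by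
    rw [Complex.conj_mul', hz]; simp
  have h1 : 1 - (starRingEnd ℂ) a * z = (starRingEnd ℂ) (z - a) * z := by
    rw [map_sub, sub_mul, hzz]
  have h2 : ‖1 - (starRingEnd ℂ) a * z‖ = ‖z - a‖ := by
    rw [h1, norm_mul, RCLike.norm_conj, hz, mul_one]
  rw [blaschkeFactor, norm_div, norm_mul, h2, norm_div, norm_neg, Complex.norm_real, norm_norm,
    div_self (norm_ne_zero_iff.2 ha0), one_mul, div_self (h2 ▸ h0.ne')]

lemma norm_blaschkeFactor_sub_one_le {a z : ℂ} (ha0 : a ≠ 0) (ha : ‖a‖ < 1) (hz : ‖z‖ < 1) :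
    ‖blaschkeFactor a z - 1‖ ≤ 2 / (1 - ‖z‖) * (1 - ‖a‖) := by
  have hd := one_sub_conj_mul_ne_zero ha hz.le
  have hna : (‖a‖ : ℂ) * ‖a‖ = a * (starRingEnd ℂ) a := by
    rw [Complex.mul_conj']; ring
  have h1 : blaschkeFactor a z - 1 =
      -((1 - (‖a‖ : ℂ)) * (a + ‖a‖ * z)) / (a * (1 - (starRingEnd ℂ) a * z)) := by
    have hd' : 1 - z * (starRingEnd ℂ) a ≠ 0 := by rwa [mul_comm]
    rw [blaschkeFactor]
    field_simp
    linear_combination -z * hna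
  have ha' : 0 < ‖a‖ := norm_pos_iff.2 ha0
  have h2 : 1 - ‖z‖ ≤ ‖1 - (starRingEnd ℂ) a * z‖ := by
    have := norm_sub_norm_le (1 : ℂ) ((starRingEnd ℂ) a * z)
    rw [norm_mul, RCLike.norm_conj, norm_one] at this
    nlinarith [norm_nonneg z]
  have h3 : ‖a + ‖a‖ * z‖ ≤ 2 * ‖a‖ := by
    refine (norm_add_le _ _).trans ?_
    rw [norm_mul, Complex.norm_real, norm_norm]
    nlinarith
  have h4 : ‖(1 - (‖a‖ : ℂ))‖ = 1 - ‖a‖ := by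
    rw [← Complex.ofReal_one, ← Complex.ofReal_sub, Complex.norm_real, Real.norm_of_nonneg]
    linarith
  have h5 : 0 < 1 - ‖z‖ := by linarith
  rw [h1, norm_div, norm_neg, norm_mul, norm_mul, h4, div_mul_eq_mul_div,
    div_le_div_iff₀ (mul_pos ha' (h5.trans_le h2)) h5]
  calc (1 - ‖a‖) * ‖a + ‖a‖ * z‖ * (1 - ‖z‖)
      ≤ (1 - ‖a‖) * (2 * ‖a‖) * ‖1 - (starRingEnd ℂ) a * z‖ := by
        have : 0 ≤ 1 - ‖a‖ := by linarith
        gcongr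
    _ = _ := by ring

lemma continuousOn_blaschkeFactor {a : ℂ} (ha : ‖a‖ < 1) :
    ContinuousOn (blaschkeFactor a) (closedBall 0 1) := by
  unfold blaschkeFactor
  refine ContinuousOn.div (by fun_prop) (by fun_prop) fun z hz => ?_
  exact one_sub_conj_mul_ne_zero ha (by simpa using hz)

lemma volume_preimage_circleMap_eq_zero {A : Set ℂ} (hA : IsClosed A) (h0 : arclength A = 0) :
    volume (circleMap 0 1 ⁻¹' A ∩ Ioc 0 (2 * Real.pi)) = 0 := by
  have hm := (continuous_circleMap 0 1).measurable
  rw [arclength, Measure.map_apply hm hA.measurableSet,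
    Measure.restrict_apply (hm hA.measurableSet)] at h0
  exact h0

lemma dist_circleMap_le (x y : ℝ) : dist (circleMap 0 1 x) (circleMap 0 1 y) ≤ dist x y := by
  simpa using (lipschitzWith_circleMap 0 1).dist_le_mul x y

/-- A compact subset of the circle of arclength zero can be covered by finitely many discs of
arbitrarily small total radius, centred at its points. -/
lemma exists_finite_cover_of_arclength_eq_zero {A : Set ℂ} (hA : IsCompact A)
    (hs : A ⊆ sphere (0 : ℂ) 1) (h0 : arclength A = 0) {τ : ℝ} (hτ : 0 < τ) :
    ∃ (t : Finset ℝ) (s : ℝ → ℝ), (∀ x ∈ t, circleMap 0 1 x ∈ A ∧ 0 < s x) ∧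
      (A ⊆ ⋃ x ∈ t, ball (circleMap 0 1 x) (s x)) ∧ ∑ x ∈ t, s x < τ := by
  set E := circleMap 0 1 ⁻¹' A ∩ Ioc 0 (2 * Real.pi) with hE
  have hE0 : volume E = 0 := volume_preimage_circleMap_eq_zero hA.isClosed h0
  obtain ⟨t, r, -, htE, hr, hcov, hsum⟩ :=
    Besicovitch.exists_closedBall_covering_tsum_measure_le (volume : Measure ℝ)
      (ε := ENNReal.ofReal (τ / 2)) (by simpa using half_pos hτ) (fun _ => Ioi 0) E
      (fun x _ δ hδ => ⟨δ / 2, by simp [hδ]⟩)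
  have hcovA : A ⊆ ⋃ x : t, ball (circleMap 0 1 x) (2 * r x) := by
    intro z hz
    have hz' := hs hz
    have : z ∈ circleMap 0 1 '' Ioc 0 (2 * Real.pi) := by
      rw [image_circleMap_Ioc]; simpa using hz'
    obtain ⟨θ, hθ, rfl⟩ := this
    obtain ⟨x, hx, hθx⟩ := mem_iUnion₂.1 (hcov ⟨hz, hθ⟩)
    refine mem_iUnion.2 ⟨⟨x, hx⟩, ?_⟩
    have := hr x hx
    rw [mem_ball]
    refine (dist_circleMap_le θ x).trans_lt ?_
    rw [mem_closedBall] at hθx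
    simp only [mem_Ioi] at this
    linarith
  obtain ⟨u, hu⟩ := hA.elim_finite_subcover _ (fun _ => isOpen_ball) hcovA
  classical
  refine ⟨u.map (Function.Embedding.subtype _), fun x => 2 * r x, ?_, ?_, ?_⟩
  · intro x hx
    simp only [Finset.mem_map, Function.Embedding.subtype_apply, Subtype.exists, exists_and_right,
      exists_eq_right] at hx
    obtain ⟨hx, -⟩ := hx
    exact ⟨(htE hx).1, mul_pos two_pos (hr x hx)⟩
  · intro z hz
    obtain ⟨x, hx, hzx⟩ := mem_iUnion₂.1 (hu hz)
    exact mem_iUnion₂.2 ⟨x, by simpa using hx, hzx⟩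
  · rw [Finset.sum_map]
    have h1 : ENNReal.ofReal (∑ x ∈ u, 2 * r (Subtype.val x)) ≤ ENNReal.ofReal (τ / 2) := by
      rw [ENNReal.ofReal_sum_of_nonneg fun (x : t) _ => (mul_pos two_pos (hr x x.2)).le]
      rw [hE0, zero_add] at hsum
      refine le_trans ?_ ((ENNReal.sum_le_tsum u).trans hsum)
      simp [Real.volume_closedBall]
    rw [ENNReal.ofReal_le_ofReal_iff (half_pos hτ).le] at h1
    simp only [Function.Embedding.subtype_apply]
    linarith

lemma totallyDisconnectedSpace_of_arclength_eq_zero {K : Set ℂ} (hK : IsCompact K)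
    (hs : K ⊆ sphere (0 : ℂ) 1) (h0 : arclength K = 0) : TotallyDisconnectedSpace K := by
  have hdist (x : ℂ) : volume ((fun z => dist z x) '' K) = 0 := by
    have hE0 := volume_preimage_circleMap_eq_zero hK.isClosed h0
    have hL : LipschitzWith (1 * Real.nnabs 1) fun θ => dist (circleMap 0 1 θ) x :=
      (LipschitzWith.dist_left x).comp (lipschitzWith_circleMap 0 1)
    have h1 := hL.hausdorffMeasure_image_le zero_le_one
      (circleMap 0 1 ⁻¹' K ∩ Ioc 0 (2 * Real.pi))
    rw [hausdorffMeasure_real, hE0, mul_zero] at h1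
    refine measure_mono_null ?_ (le_antisymm h1 bot_le)
    rintro _ ⟨z, hz, rfl⟩
    have hz' := hs hz
    have : z ∈ circleMap 0 1 '' Ioc 0 (2 * Real.pi) := by
      rw [image_circleMap_Ioc]; simpa using hz'
    obtain ⟨θ, hθ, rfl⟩ := this
    exact ⟨θ, ⟨hz, hθ⟩, rfl⟩
  suffices TotallySeparatedSpace K from inferInstance
  refine totallySeparatedSpace_iff_exists_isClopen.2 fun x y hxy => ?_
  have hpos : 0 < dist y x := dist_pos.2 hxy.symm
  obtain ⟨ρ, hρ, hρK⟩ : ∃ ρ ∈ Ioo 0 (dist y x), ρ ∉ (fun z => dist z (x : ℂ)) '' K := by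
    by_contra! h
    have h1 := measure_mono_null h (hdist x)
    rw [Real.volume_Ioo, ENNReal.ofReal_eq_zero] at h1
    linarith
  have heq : ball x ρ = closedBall x ρ := by
    ext z
    simp only [mem_ball, mem_closedBall]
    refine ⟨le_of_lt, fun h => lt_of_le_of_ne h fun h' => hρK ⟨z, z.2, h'⟩⟩
  refine ⟨ball x ρ, ⟨heq ▸ isClosed_closedBall, isOpen_ball⟩, mem_ball_self hρ.1, ?_⟩
  simpa using hρ.2.le

lemma norm_prod_sub_prod_le {ι : Type*} (s : Finset ι) {a b : ι → ℂ} (ha : ∀ i ∈ s, ‖a i‖ ≤ 1)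
    (hb : ∀ i ∈ s, ‖b i‖ ≤ 1) : ‖∏ i ∈ s, a i - ∏ i ∈ s, b i‖ ≤ ∑ i ∈ s, ‖a i - b i‖ := by
  classical
  induction s using Finset.induction_on with
  | empty => simp
  | insert i s his ih =>
    simp only [Finset.forall_mem_insert] at ha hb
    rw [Finset.prod_insert his, Finset.prod_insert his, Finset.sum_insert his]
    have h1 : ‖∏ i ∈ s, a i‖ ≤ 1 := by
      rw [norm_prod]; exact Finset.prod_le_one (fun _ _ => norm_nonneg _) ha.2
    calc ‖a i * ∏ j ∈ s, a j - b i * ∏ j ∈ s, b j‖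
        = ‖(a i - b i) * ∏ j ∈ s, a j + b i * (∏ j ∈ s, a j - ∏ j ∈ s, b j)‖ := by ring_nf
      _ ≤ ‖a i - b i‖ * ‖∏ j ∈ s, a j‖ + ‖b i‖ * ‖∏ j ∈ s, a j - ∏ j ∈ s, b j‖ := by
        refine (norm_add_le _ _).trans_eq ?_
        rw [norm_mul, norm_mul]
      _ ≤ ‖a i - b i‖ * 1 + 1 * ∑ j ∈ s, ‖a j - b j‖ := by
        gcongr
        · exact hb.1
        · exact ih ha.2 hb.2
      _ = _ := by ring

/-- A Möbius map from the right half plane into the disc, sending `0` to `1` and `∞` to `c`. -/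
def halfPlaneToDisc (c q : ℂ) : ℂ := (1 - c + c * q) / (1 - c + q)

section halfPlaneToDisc

variable {c q : ℂ}

lemma re_le_re_one_sub_add : q.re + (1 - ‖c‖) ≤ (1 - c + q).re := by
  have := Complex.re_le_norm c
  simp only [Complex.add_re, Complex.sub_re, Complex.one_re]
  linarith

lemma one_sub_add_ne_zero (hc : ‖c‖ < 1) (hq : 0 ≤ q.re) : 1 - c + q ≠ 0 := by
  intro h
  have := re_le_re_one_sub_add (c := c) (q := q)
  rw [h, Complex.zero_re] at this
  linarith

lemma norm_halfPlaneToDisc_le_one (hc : ‖c‖ < 1) (hq : 0 ≤ q.re) :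
    ‖halfPlaneToDisc c q‖ ≤ 1 := by
  rw [halfPlaneToDisc, norm_div, div_le_one (norm_pos_iff.2 (one_sub_add_ne_zero hc hq))]
  have key : ‖1 - c + q‖ ^ 2 - ‖1 - c + c * q‖ ^ 2 =
      ‖q‖ ^ 2 * (1 - ‖c‖ ^ 2) + 2 * ‖1 - c‖ ^ 2 * q.re := by
    simp only [Complex.sq_norm, Complex.normSq_apply, Complex.sub_re, Complex.sub_im,
      Complex.mul_re, Complex.mul_im, Complex.add_re, Complex.add_im, Complex.one_re,
      Complex.one_im]
    ring
  have h1 : 0 ≤ ‖q‖ ^ 2 * (1 - ‖c‖ ^ 2) :=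
    mul_nonneg (sq_nonneg _) (by nlinarith [norm_nonneg c])
  have h2 : 0 ≤ 2 * ‖1 - c‖ ^ 2 * q.re := by positivity
  exact le_of_sq_le_sq (by linarith) (norm_nonneg _)

lemma norm_halfPlaneToDisc_sub_le (hc : ‖c‖ < 1) (hq : 0 < q.re) :
    ‖halfPlaneToDisc c q - c‖ ≤ 4 / q.re := by
  have h0 := one_sub_add_ne_zero hc hq.le
  have h1 : halfPlaneToDisc c q - c = (1 - c) ^ 2 / (1 - c + q) := by
    rw [halfPlaneToDisc]; field_simp; ring
  have h2 : q.re ≤ ‖1 - c + q‖ :=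
    le_trans (by linarith [re_le_re_one_sub_add (c := c) (q := q)]) (Complex.re_le_norm _)
  have h3 : ‖1 - c‖ ≤ 2 := by
    have := norm_sub_le (1 : ℂ) c
    rw [norm_one] at this
    linarith
  rw [h1, norm_div, norm_pow]
  gcongr
  nlinarith [norm_nonneg (1 - c)]

lemma norm_halfPlaneToDisc_sub_one_le (hc : ‖c‖ < 1) (hq : 0 ≤ q.re) :
    ‖halfPlaneToDisc c q - 1‖ ≤ 2 * ‖q‖ / (1 - ‖c‖) := by
  have h0 := one_sub_add_ne_zero hc hq
  have h1 : halfPlaneToDisc c q - 1 = -((1 - c) * q) / (1 - c + q) := by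
    rw [halfPlaneToDisc]; field_simp; ring
  have h2 : 1 - ‖c‖ ≤ ‖1 - c + q‖ :=
    le_trans (by linarith [re_le_re_one_sub_add (c := c) (q := q)]) (Complex.re_le_norm _)
  have h3 : ‖1 - c‖ ≤ 2 := by
    have := norm_sub_le (1 : ℂ) c
    rw [norm_one] at this
    linarith
  have h4 : 0 < 1 - ‖c‖ := by linarith
  rw [h1, norm_div, norm_neg, norm_mul]
  gcongr

end halfPlaneToDisc

section pole

variable {ζ z : ℂ} {s : ℝ}

lemma norm_one_sub_conj_mul_eq (hζ : ‖ζ‖ = 1) : ‖1 - (starRingEnd ℂ) ζ * z‖ = ‖z - ζ‖ := by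
  have hzz : (starRingEnd ℂ) ζ * ζ = 1 := by rw [Complex.conj_mul', hζ]; simp
  rw [← hzz, ← mul_sub, norm_mul, RCLike.norm_conj, hζ, one_mul, norm_sub_rev]

lemma le_re_one_add_sub (hζ : ‖ζ‖ = 1) (hz : ‖z‖ ≤ 1) :
    s ≤ (1 + s - (starRingEnd ℂ) ζ * z).re := by
  have h := Complex.re_le_norm ((starRingEnd ℂ) ζ * z)
  rw [norm_mul, RCLike.norm_conj, hζ, one_mul] at h
  simp only [Complex.sub_re, Complex.add_re, Complex.one_re, Complex.ofReal_re]
  linarith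

lemma one_add_sub_ne_zero (hζ : ‖ζ‖ = 1) (hz : ‖z‖ ≤ 1) (hs : 0 < s) :
    1 + (s : ℂ) - (starRingEnd ℂ) ζ * z ≠ 0 := by
  intro h
  have := le_re_one_add_sub (s := s) hζ hz
  rw [h, Complex.zero_re] at this
  linarith

lemma re_inv_one_add_sub_nonneg (hζ : ‖ζ‖ = 1) (hz : ‖z‖ ≤ 1) (hs : 0 < s) :
    0 ≤ ((1 + s - (starRingEnd ℂ) ζ * z)⁻¹).re := by
  rw [Complex.inv_re]
  exact div_nonneg (hs.le.trans (le_re_one_add_sub hζ hz)) (Complex.normSq_nonneg _)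

lemma le_re_inv_one_add_sub (hζ : ‖ζ‖ = 1) (hz : ‖z‖ ≤ 1) (hs : 0 < s) (hzs : ‖z - ζ‖ ≤ s) :
    1 / (4 * s) ≤ ((1 + s - (starRingEnd ℂ) ζ * z)⁻¹).re := by
  have h0 := one_add_sub_ne_zero hζ hz hs
  have h1 : ‖1 + s - (starRingEnd ℂ) ζ * z‖ ≤ 2 * s := by
    have : 1 + s - (starRingEnd ℂ) ζ * z = (1 - (starRingEnd ℂ) ζ * z) + s := by ring
    rw [this]
    refine (norm_add_le _ _).trans ?_
    rw [norm_one_sub_conj_mul_eq hζ, Complex.norm_real, Real.norm_of_nonneg hs.le]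
    linarith
  have h2 : Complex.normSq (1 + s - (starRingEnd ℂ) ζ * z) ≤ 4 * s ^ 2 := by
    rw [Complex.normSq_eq_norm_sq]
    nlinarith [norm_nonneg (1 + s - (starRingEnd ℂ) ζ * z)]
  rw [Complex.inv_re]
  calc 1 / (4 * s) = s / (4 * s ^ 2) := by field_simp
    _ ≤ _ := by
      have h3 := le_re_one_add_sub (s := s) hζ hz
      exact div_le_div₀ (hs.le.trans h3) h3 (Complex.normSq_pos.2 h0) h2

lemma norm_sub_le_norm_one_add_sub (hζ : ‖ζ‖ = 1) (hz : ‖z‖ ≤ 1) (hs : 0 < s) :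
    ‖z - ζ‖ ≤ ‖1 + s - (starRingEnd ℂ) ζ * z‖ := by
  rw [← norm_one_sub_conj_mul_eq hζ]
  set w := (starRingEnd ℂ) ζ * z with hw
  have h := le_re_one_add_sub (s := s) hζ hz
  rw [← hw] at h
  have key : ‖1 + s - w‖ ^ 2 - ‖1 - w‖ ^ 2 = s ^ 2 + 2 * s * ((1 + s - w).re - s) := by
    simp only [Complex.sq_norm, Complex.normSq_apply, Complex.sub_re, Complex.sub_im,
      Complex.add_re, Complex.add_im, Complex.one_re, Complex.one_im, Complex.ofReal_re,
      Complex.ofReal_im]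
    ring
  have h2 : 0 ≤ 2 * s * ((1 + s - w).re - s) := mul_nonneg (by linarith) (by linarith)
  exact le_of_sq_le_sq (by nlinarith) (norm_nonneg _)

end pole

/-- A function in the disc algebra which is close to a constant `c` on a given null compact subset
of the circle, and close to `1` at a positive distance from it. -/
lemma exists_analytic_near_const {A D : Set ℂ} (hA : IsCompact A) (hs : A ⊆ sphere (0 : ℂ) 1)
    (h0 : arclength A = 0) {c : ℂ} (hc : ‖c‖ < 1) {d : ℝ} (hd : 0 < d)
    (hAD : ∀ x ∈ A, ∀ y ∈ D, d ≤ dist x y) (hD : D ⊆ closedBall 0 1) {ε : ℝ} (hε : 0 < ε) :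
    ∃ F : ℂ → ℂ, (∀ z ∈ closedBall (0 : ℂ) 1, AnalyticAt ℂ F z ∧ ‖F z‖ ≤ 1) ∧
      (∀ z ∈ A, ‖F z - c‖ ≤ ε) ∧ ∀ z ∈ D, ‖F z - 1‖ ≤ ε := by
  have hc' : 0 < 1 - ‖c‖ := by linarith
  set m : ℝ := 16 / ε with hm
  have hm0 : 0 < m := by positivity
  obtain ⟨t, s, hts, hcov, hsum⟩ := exists_finite_cover_of_arclength_eq_zero hA hs h0
    (τ := ε * (1 - ‖c‖) * d / (2 * m)) (by positivity)
  have hζ (x : ℝ) : ‖circleMap 0 1 x‖ = 1 := by simp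
  set T : ℝ → ℂ → ℂ := fun x z =>
    ((m * s x : ℝ) : ℂ) * (1 + s x - (starRingEnd ℂ) (circleMap 0 1 x) * z)⁻¹ with hT
  set q : ℂ → ℂ := fun z => ∑ x ∈ t, T x z with hq
  have hTre (z : ℂ) (hz : ‖z‖ ≤ 1) (x : ℝ) (hx : x ∈ t) : 0 ≤ (T x z).re := by
    rw [hT, Complex.re_ofReal_mul]
    have := (hts x hx).2
    exact mul_nonneg (by positivity) (re_inv_one_add_sub_nonneg (hζ x) hz this)
  have hqre (z : ℂ) (hz : ‖z‖ ≤ 1) : 0 ≤ (q z).re := by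
    rw [hq, Complex.re_sum]
    exact Finset.sum_nonneg (hTre z hz)
  refine ⟨fun z => halfPlaneToDisc c (q z), fun z hz => ?_, fun z hz => ?_, fun z hz => ?_⟩
  · rw [mem_closedBall_zero_iff] at hz
    refine ⟨?_, norm_halfPlaneToDisc_le_one hc (hqre z hz)⟩
    have hqa : AnalyticAt ℂ q z := by
      refine Finset.analyticAt_fun_sum _ fun x hx => ?_
      exact analyticAt_const.mul (AnalyticAt.inv (by fun_prop)
        (one_add_sub_ne_zero (hζ x) hz (hts x hx).2))
    exact AnalyticAt.div (by fun_prop) (by fun_prop) (one_sub_add_ne_zero hc (hqre z hz))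
  · have hz1 : ‖z‖ = 1 := by simpa using hs hz
    obtain ⟨x, hx, hzx⟩ := mem_iUnion₂.1 (hcov hz)
    have hsx := (hts x hx).2
    have h1 : m / 4 ≤ (T x z).re := by
      rw [hT, Complex.re_ofReal_mul]
      rw [mem_ball, dist_eq_norm] at hzx
      have := le_re_inv_one_add_sub (hζ x) hz1.le hsx hzx.le
      calc m / 4 = m * s x * (1 / (4 * s x)) := by field_simp
        _ ≤ _ := by gcongr
    have h2 : m / 4 ≤ (q z).re := by
      rw [hq, Complex.re_sum]
      exact h1.trans (Finset.single_le_sum (hTre z hz1.le) hx)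
    have h3 : 0 < (q z).re := lt_of_lt_of_le (by positivity) h2
    refine (norm_halfPlaneToDisc_sub_le hc h3).trans ?_
    rw [div_le_iff₀ h3]
    calc (4 : ℝ) = ε * (m / 4) := by rw [hm]; field_simp; norm_num
      _ ≤ _ := by gcongr
  · have hz1 : ‖z‖ ≤ 1 := by simpa using hD hz
    refine (norm_halfPlaneToDisc_sub_one_le hc (hqre z hz1)).trans ?_
    have h1 : ‖q z‖ ≤ m / d * ∑ x ∈ t, s x := by
      rw [hq, Finset.mul_sum]
      refine norm_sum_le_of_le _ fun x hx => ?_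
      have hsx := (hts x hx).2
      have h2 := (hAD _ (hts x hx).1 z hz).trans ((dist_comm _ _).trans_le
        ((dist_eq_norm _ _).trans_le (norm_sub_le_norm_one_add_sub (hζ x) hz1 hsx)))
      rw [hT, norm_mul, norm_inv, Complex.norm_real, Real.norm_of_nonneg (by positivity)]
      calc m * s x * ‖1 + s x - (starRingEnd ℂ) (circleMap 0 1 x) * z‖⁻¹ ≤ m * s x * d⁻¹ := by
            gcongr
        _ = _ := by ring
    rw [div_le_iff₀ hc']
    calc 2 * ‖q z‖ ≤ 2 * (m / d * (ε * (1 - ‖c‖) * d / (2 * m))) := by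
          grw [h1, hsum]
      _ = _ := by field_simp

/-- On a compact subset of the circle of arclength zero, every continuous function bounded by `1`
is uniformly approximated by functions of the disc algebra which are bounded by `1` and close to
`1` at the origin. -/
lemma exists_analytic_approx {K : Set ℂ} (hK : IsCompact K) (hs : K ⊆ sphere (0 : ℂ) 1)
    (h0 : arclength K = 0) (φ : C(K, ℂ)) (hφ : ∀ z, ‖φ z‖ ≤ 1) {ε : ℝ} (hε : 0 < ε) :
    ∃ f : ℂ → ℂ, (∀ z ∈ closedBall (0 : ℂ) 1, AnalyticAt ℂ f z ∧ ‖f z‖ ≤ 1) ∧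
      ‖f 0 - 1‖ < ε ∧ ∀ z : K, ‖f z - φ z‖ < ε := by
  classical
  have := totallyDisconnectedSpace_of_arclength_eq_zero hK hs h0
  have := isCompact_iff_compactSpace.1 hK
  obtain ⟨n, D, hDne, hDφ, hDcov, hDdisj⟩ :=
    φ.exists_disjoint_nonempty_clopen_cover_of_mem_nhds_diagonal (S := {p | dist p.1 p.2 < ε / 3})
      ((isOpen_lt (by fun_prop) continuous_const).mem_nhdsSet.2
        (by rintro ⟨a, b⟩ (rfl : a = b); simp; positivity))
  have hne (i : Fin n) : ∃ x, x ∈ D i := by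
    by_contra! h
    exact hDne i (by ext x; simp [h x])
  choose x hx using hne
  set δ : ℝ := min (ε / 3) (1 / 2) with hδ
  have hδ0 : 0 < δ := by positivity
  have hδ1 : δ ≤ 1 / 2 := min_le_right _ _
  have hδε : δ ≤ ε / 3 := min_le_left _ _
  have hnδ : ‖(1 - δ : ℂ)‖ = 1 - δ := by
    rw [← Complex.ofReal_one, ← Complex.ofReal_sub, Complex.norm_real, Real.norm_of_nonneg]
    linarith
  set c : Fin n → ℂ := fun i => (1 - δ : ℂ) * φ (x i) with hc
  have hc1 (i : Fin n) : ‖c i‖ < 1 := by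
    rw [hc, norm_mul, hnδ]
    nlinarith [hφ (x i), norm_nonneg (φ (x i))]
  set A : Fin n → Set ℂ := fun i => Subtype.val '' (D i : Set K) with hA
  have hAK (i : Fin n) : A i ⊆ K := by rintro _ ⟨y, -, rfl⟩; exact y.2
  have hAc (i : Fin n) : IsCompact (A i) :=
    (D i).isClopen.isClosed.isCompact.image continuous_subtype_val
  set C : Fin n → Set ℂ := fun i => insert 0 (Subtype.val '' ((D i : Set K)ᶜ)) with hC
  have hCc (i : Fin n) : IsClosed (C i) :=
    (((D i).isClopen.compl.isClosed.isCompact.image continuous_subtype_val).insert 0).isClosed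
  have hCb (i : Fin n) : C i ⊆ closedBall 0 1 := by
    rintro z (rfl | ⟨y, -, rfl⟩)
    · simp
    · exact sphere_subset_closedBall (hs y.2)
  have hAC (i : Fin n) : Disjoint (A i) (C i) := by
    rw [Set.disjoint_left]
    rintro _ ⟨y, hy, rfl⟩ (h | ⟨w, hw, hwy⟩)
    · have := hs y.2
      rw [h] at this
      simp at this
    · rw [Subtype.val_injective hwy] at hw
      exact hw hy
  have hF (i : Fin n) : ∃ F : ℂ → ℂ, (∀ z ∈ closedBall (0 : ℂ) 1, AnalyticAt ℂ F z ∧ ‖F z‖ ≤ 1) ∧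
      (∀ z ∈ A i, ‖F z - c i‖ ≤ ε / (3 * (n + 1))) ∧
      ∀ z ∈ C i, ‖F z - 1‖ ≤ ε / (3 * (n + 1)) := by
    obtain ⟨r, hr, hrAC⟩ := exists_pos_forall_lt_edist (hAc i) (hCc i) (hAC i)
    refine exists_analytic_near_const (hAc i) ((hAK i).trans hs) (measure_mono_null (hAK i) h0)
      (hc1 i) (d := r) (by exact_mod_cast hr) (fun a ha b hb => ?_) (hCb i) (by positivity)
    have := hrAC a ha b hb
    rw [edist_nndist, ENNReal.coe_lt_coe] at this
    exact_mod_cast this.le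
  choose F hF1 hFA hFC using hF
  have hsum {a : Fin n → ℝ} (ha : ∀ i, a i ≤ ε / (3 * (n + 1))) : ∑ i, a i < ε / 3 := by
    refine (Finset.sum_le_sum fun i _ => ha i).trans_lt ?_
    rw [Finset.sum_const, Finset.card_univ, Fintype.card_fin, nsmul_eq_mul, mul_div_assoc',
      div_lt_div_iff₀ (by positivity) (by positivity)]
    nlinarith
  have h01 : (0 : ℂ) ∈ closedBall (0 : ℂ) 1 := by simp
  refine ⟨fun z => ∏ i, F i z, fun z hz => ⟨?_, ?_⟩, ?_, fun z => ?_⟩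
  · exact Finset.analyticAt_fun_prod _ fun i _ => (hF1 i z hz).1
  · rw [norm_prod]
    exact Finset.prod_le_one (fun _ _ => norm_nonneg _) fun i _ => (hF1 i z hz).2
  · have h1 := norm_prod_sub_prod_le Finset.univ (a := fun i => F i 0) (b := fun _ => 1)
      (fun i _ => (hF1 i 0 h01).2) (by simp)
    rw [Finset.prod_const_one] at h1
    have := h1.trans_lt (hsum fun i => hFC i 0 (mem_insert _ _))
    linarith
  · obtain ⟨j, hj⟩ := mem_iUnion.1 (hDcov (mem_univ z))
    have hz1 : (z : ℂ) ∈ closedBall (0 : ℂ) 1 := sphere_subset_closedBall (hs z.2)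
    have h1 := norm_prod_sub_prod_le Finset.univ (a := fun i => F i z)
      (b := fun i => if i = j then c j else 1)
      (fun i _ => (hF1 i z hz1).2) (fun i _ => by split_ifs; exacts [(hc1 j).le, by simp])
    rw [Finset.prod_ite_eq' Finset.univ j, if_pos (Finset.mem_univ _)] at h1
    have h2 := h1.trans_lt (hsum fun i => by
      split_ifs with hij
      · subst hij
        exact hFA i z ⟨z, hj, rfl⟩
      · refine hFC i z (mem_insert_of_mem _ ⟨z, fun hzi => ?_, rfl⟩)
        have : z ∈ (⊥ : TopologicalSpace.Clopens K) := (hDdisj hij).le_bot ⟨hzi, hj⟩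
        exact this)
    have h3 : ‖φ (x j) - φ z‖ < ε / 3 := by
      rw [← dist_eq_norm]; exact hDφ j _ (hx j) _ hj
    have h4 : ‖c j - φ (x j)‖ ≤ ε / 3 := by
      have : c j - φ (x j) = -((δ : ℂ) * φ (x j)) := by rw [hc]; ring
      rw [this, norm_neg, norm_mul, Complex.norm_real, Real.norm_of_nonneg hδ0.le]
      nlinarith [hφ (x j)]
    have h5 := norm_add₃_le (a := ∏ i, F i z - c j) (b := c j - φ (x j)) (c := φ (x j) - φ z)
    rw [sub_add_sub_cancel, sub_add_sub_cancel] at h5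
    linarith

lemma exists_one_lt_closedBall_subset {U : Set ℂ} (hU : IsOpen U)
    (h : closedBall (0 : ℂ) 1 ⊆ U) : ∃ R : ℝ, 1 < R ∧ closedBall (0 : ℂ) R ⊆ U := by
  obtain ⟨δ, hδ, hδU⟩ := (isCompact_closedBall (0 : ℂ) 1).exists_cthickening_subset_open hU h
  rw [cthickening_closedBall hδ.le zero_le_one] at hδU
  exact ⟨δ + 1, by linarith, hδU⟩

open Polynomial in
lemma exists_polynomial_approx {f : ℂ → ℂ}
    (hf : ∀ z ∈ closedBall (0 : ℂ) 1, AnalyticAt ℂ f z) {ε : ℝ} (hε : 0 < ε) :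
    ∃ p : ℂ[X], ∀ z ∈ closedBall (0 : ℂ) 1, ‖p.eval z - f z‖ < ε := by
  obtain ⟨R, hR, hRU⟩ := exists_one_lt_closedBall_subset (isOpen_analyticAt ℂ f) hf
  lift R to NNReal using by linarith
  have hd : DifferentiableOn ℂ f (closedBall 0 R) := fun z hz =>
    (hRU hz).differentiableAt.differentiableWithinAt
  have hR' : (1 : NNReal) < R := by exact_mod_cast hR
  have hps := hd.hasFPowerSeriesOnBall (zero_lt_one.trans hR')
  obtain ⟨r, hr1, hrR⟩ := exists_between hR'
  have hu := Metric.tendstoUniformlyOn_iff.1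
    (hps.tendstoUniformlyOn' (r' := r) (by exact_mod_cast hrR)) ε hε
  obtain ⟨n, hn⟩ := hu.exists
  refine ⟨∑ k ∈ Finset.range n, Polynomial.C ((cauchyPowerSeries f 0 R).coeff k) * X ^ k, fun z hz => ?_⟩
  have hz' : z ∈ ball (0 : ℂ) r := by
    have : (1 : ℝ) < r := by exact_mod_cast hr1
    exact closedBall_subset_ball this hz
  have := hn z hz'
  rw [dist_eq_norm, norm_sub_rev] at this
  have heq : (∑ k ∈ Finset.range n, Polynomial.C ((cauchyPowerSeries f 0 R).coeff k) * X ^ k).eval z =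
      (cauchyPowerSeries f 0 R).partialSum n (z - 0) := by
    rw [eval_finsetSum, FormalMultilinearSeries.partialSum]
    refine Finset.sum_congr rfl fun k _ => ?_
    rw [FormalMultilinearSeries.apply_eq_pow_smul_coeff, eval_mul, eval_C, eval_pow, eval_X,
      sub_zero, smul_eq_mul, mul_comm]
  rwa [heq]

open Polynomial in
lemma exists_polynomial_norm_lt_one_approx {f : ℂ → ℂ}
    (hf : ∀ z ∈ closedBall (0 : ℂ) 1, AnalyticAt ℂ f z ∧ ‖f z‖ ≤ 1) {ε : ℝ} (hε : 0 < ε) :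
    ∃ p : ℂ[X], ∀ z ∈ closedBall (0 : ℂ) 1, ‖p.eval z‖ < 1 ∧ ‖p.eval z - f z‖ < ε := by
  set δ : ℝ := min (ε / 2) (1 / 2) with hδ
  have hδ0 : 0 < δ := by positivity
  have hδ1 : δ ≤ 1 / 2 := min_le_right _ _
  have hδε : δ ≤ ε / 2 := min_le_left _ _
  have hnδ : ‖(1 - δ : ℂ)‖ = 1 - δ := by
    rw [← Complex.ofReal_one, ← Complex.ofReal_sub, Complex.norm_real, Real.norm_of_nonneg]
    linarith
  obtain ⟨p, hp⟩ := exists_polynomial_approx (f := fun z => (1 - δ : ℂ) * f z)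
    (fun z hz => analyticAt_const.mul (hf z hz).1) hδ0
  refine ⟨p, fun z hz => ?_⟩
  have h1 := hp z hz
  have h2 := (hf z hz).2
  constructor
  · have h3 : ‖(1 - δ : ℂ) * f z‖ ≤ 1 - δ := by
      rw [norm_mul, hnδ]
      exact mul_le_of_le_one_right (by linarith) h2
    have h4 := norm_le_norm_sub_add (p.eval z) ((1 - δ : ℂ) * f z)
    linarith
  · have h3 : ‖(1 - δ : ℂ) * f z - f z‖ ≤ δ := by
      have : (1 - δ : ℂ) * f z - f z = -((δ : ℂ) * f z) := by ring
      rw [this, norm_neg, norm_mul, Complex.norm_real, Real.norm_of_nonneg hδ0.le]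
      exact mul_le_of_le_one_right hδ0.le h2
    have h4 := norm_sub_le_norm_sub_add_norm_sub (p.eval z) ((1 - δ : ℂ) * f z) (f z)
    linarith

open Polynomial in
lemma exists_norm_eval_le_mul_pow (p : ℂ[X]) :
    ∃ M : ℝ, 1 ≤ M ∧ ∀ w : ℂ, 1 ≤ ‖w‖ → ‖p.eval w‖ ≤ M * ‖w‖ ^ p.natDegree := by
  have hpos : 0 ≤ ∑ k ∈ Finset.range (p.natDegree + 1), ‖p.coeff k‖ :=
    Finset.sum_nonneg fun _ _ => norm_nonneg _
  refine ⟨1 + ∑ k ∈ Finset.range (p.natDegree + 1), ‖p.coeff k‖, by linarith, fun w hw => ?_⟩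
  calc ‖p.eval w‖ ≤ ∑ k ∈ Finset.range (p.natDegree + 1), ‖p.coeff k‖ * ‖w‖ ^ p.natDegree := by
        rw [Polynomial.eval_eq_sum_range]
        refine norm_sum_le_of_le _ fun k hk => ?_
        rw [norm_mul, norm_pow]
        gcongr
        exact Nat.lt_succ_iff.1 (Finset.mem_range.1 hk)
    _ ≤ _ := by
        rw [← Finset.sum_mul]
        exact mul_le_mul_of_nonneg_right (by linarith) (by positivity)

/-- The finite Blaschke product with zeros `s`, normalised to be positive at the origin. -/
def blaschkeProd (s : Multiset ℂ) (z : ℂ) : ℂ := (s.map fun a => blaschkeFactor a z).prod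

lemma blaschkeProd_zero (z : ℂ) : blaschkeProd 0 z = 1 := by simp [blaschkeProd]

lemma blaschkeProd_add (s t : Multiset ℂ) (z : ℂ) :
    blaschkeProd (s + t) z = blaschkeProd s z * blaschkeProd t z := by
  simp [blaschkeProd]

lemma blaschkeProd_cons (a : ℂ) (s : Multiset ℂ) (z : ℂ) :
    blaschkeProd (a ::ₘ s) z = blaschkeFactor a z * blaschkeProd s z := by
  simp [blaschkeProd]

lemma norm_blaschkeProd_le_one {s : Multiset ℂ} (hs : ∀ a ∈ s, a ≠ 0 ∧ ‖a‖ < 1) {z : ℂ}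
    (hz : ‖z‖ ≤ 1) : ‖blaschkeProd s z‖ ≤ 1 := by
  induction s using Multiset.induction_on with
  | empty => simp [blaschkeProd_zero]
  | cons a s ih =>
    rw [Multiset.forall_mem_cons] at hs
    rw [blaschkeProd_cons, norm_mul]
    exact mul_le_one₀ (norm_blaschkeFactor_le_one hs.1.2 hz) (norm_nonneg _) (ih hs.2)

lemma norm_blaschkeProd_eq_one {s : Multiset ℂ} (hs : ∀ a ∈ s, a ≠ 0 ∧ ‖a‖ < 1) {z : ℂ}
    (hz : ‖z‖ = 1) : ‖blaschkeProd s z‖ = 1 := by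
  induction s using Multiset.induction_on with
  | empty => simp [blaschkeProd_zero]
  | cons a s ih =>
    rw [Multiset.forall_mem_cons] at hs
    rw [blaschkeProd_cons, norm_mul, ih hs.2, norm_blaschkeFactor_eq_one hs.1.1 hs.1.2 hz, one_mul]

lemma continuousOn_blaschkeProd {s : Multiset ℂ} (hs : ∀ a ∈ s, a ≠ 0 ∧ ‖a‖ < 1) :
    ContinuousOn (blaschkeProd s) (closedBall 0 1) := by
  induction s using Multiset.induction_on with
  | empty => exact continuousOn_const.congr fun z _ => blaschkeProd_zero z
  | cons a s ih =>
    rw [Multiset.forall_mem_cons] at hs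
    exact ((continuousOn_blaschkeFactor hs.1.2).mul (ih hs.2)).congr fun z _ =>
      blaschkeProd_cons a s z

lemma norm_blaschkeProd_sub_one_le {s : Multiset ℂ} (hs : ∀ a ∈ s, a ≠ 0 ∧ ‖a‖ < 1) {z : ℂ}
    (hz : ‖z‖ < 1) :
    ‖blaschkeProd s z - 1‖ ≤ 2 / (1 - ‖z‖) * (s.map fun a => 1 - ‖a‖).sum := by
  induction s using Multiset.induction_on with
  | empty => simp [blaschkeProd_zero]
  | cons a s ih =>
    rw [Multiset.forall_mem_cons] at hs
    have h1 := norm_blaschkeFactor_le_one hs.1.2 hz.le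
    have h2 := norm_blaschkeFactor_sub_one_le hs.1.1 hs.1.2 hz
    have h3 := ih hs.2
    rw [blaschkeProd_cons, Multiset.map_cons, Multiset.sum_cons]
    calc ‖blaschkeFactor a z * blaschkeProd s z - 1‖
        = ‖blaschkeFactor a z * (blaschkeProd s z - 1) + (blaschkeFactor a z - 1)‖ := by ring_nf
      _ ≤ ‖blaschkeFactor a z‖ * ‖blaschkeProd s z - 1‖ + ‖blaschkeFactor a z - 1‖ := by
        rw [← norm_mul]; exact norm_add_le _ _
      _ ≤ 1 * ‖blaschkeProd s z - 1‖ + ‖blaschkeFactor a z - 1‖ := by gcongr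
      _ ≤ _ := by linarith

lemma blaschkeProd_eq_mul (s : Multiset ℂ) (z : ℂ) :
    blaschkeProd s z = (s.map fun a => -(‖a‖ : ℂ) / a).prod *
      ((s.map fun a => z - a).prod / (s.map fun a => 1 - (starRingEnd ℂ) a * z).prod) := by
  rw [← Multiset.prod_map_div, ← Multiset.prod_map_mul]
  simp only [blaschkeProd, blaschkeFactor, mul_div_assoc]

lemma sum_one_sub_norm_le_neg_log {s : Multiset ℂ} (hs : ∀ a ∈ s, a ≠ 0 ∧ ‖a‖ < 1) :
    (s.map fun a => 1 - ‖a‖).sum ≤ -Real.log (s.map fun a => ‖a‖).prod := by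
  induction s using Multiset.induction_on with
  | empty => simp
  | cons a s ih =>
    rw [Multiset.forall_mem_cons] at hs
    have h0 : 0 < (s.map fun a => ‖a‖).prod := by
      refine Multiset.prod_pos fun x hx => ?_
      obtain ⟨b, hb, rfl⟩ := Multiset.mem_map.1 hx
      exact norm_pos_iff.2 (hs.2 b hb).1
    have h1 : 0 < ‖a‖ := norm_pos_iff.2 hs.1.1
    rw [Multiset.map_cons, Multiset.sum_cons, Multiset.map_cons, Multiset.prod_cons,
      Real.log_mul h1.ne' h0.ne']
    have := Real.log_le_sub_one_of_pos h1
    linarith [ih hs.2]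

open Polynomial in
/-- **Carathéodory's theorem** for polynomials bounded by `1` on the closed disc: up to a
unimodular constant, the approximating Blaschke product is `(zᴺ + p) / (1 + p*)`, where `p*` is the
reversed conjugate of `p`. -/
lemma exists_blaschkeProd_near_polynomial {p : ℂ[X]}
    (hp : ∀ z ∈ closedBall (0 : ℂ) 1, ‖p.eval z‖ < 1) (hp0 : p.eval 0 ≠ 0) {r : ℝ} (hr0 : 0 < r)
    (hr : r < 1) {ε : ℝ} (hε : 0 < ε) :
    ∃ s : Multiset ℂ, s ≠ 0 ∧ (∀ a ∈ s, a ≠ 0 ∧ ‖a‖ < 1) ∧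
      (s.map fun a => ‖a‖).prod = ‖p.eval 0‖ ∧
      ∀ z : ℂ, 0 < ‖z‖ → ‖z‖ ≤ r →
        ‖p.eval 0 / ‖p.eval 0‖ * blaschkeProd s z - p.eval z‖ < ε := by
  obtain ⟨M, hM1, hM⟩ := exists_norm_eval_le_mul_pow p
  obtain ⟨R, hR, hRp⟩ := exists_one_lt_closedBall_subset (U := {z | ‖p.eval z‖ < 1})
    (isOpen_lt (by fun_prop) continuous_const) hp
  obtain ⟨k, hkR, hkr, hk⟩ : ∃ k : ℕ, M < R ^ k ∧ M * r ^ k < min (1 / 2) (ε / 4) ∧ 1 ≤ k := by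
    have h1 := (tendsto_pow_atTop_atTop_of_one_lt hR).eventually_gt_atTop M
    have h2 : Tendsto (fun k : ℕ => M * r ^ k) atTop (nhds (M * 0)) :=
      (tendsto_pow_atTop_nhds_zero_of_lt_one hr0.le hr).const_mul M
    rw [mul_zero] at h2
    have h3 := h2.eventually_lt_const (u := min (1 / 2) (ε / 4)) (by positivity)
    exact (h1.and (h3.and (eventually_ge_atTop 1))).exists
  set d := p.natDegree with hd
  set N := d + k with hN
  have hdeg : p.degree < N := by
    refine p.degree_le_natDegree.trans_lt ?_
    exact_mod_cast (by omega : p.natDegree < N)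
  set Q : ℂ[X] := X ^ N + p with hQ
  have hQm : Q.Monic := monic_X_pow_add hdeg
  have hQsplit : Q.Splits := IsAlgClosed.splits Q
  have hcard : Multiset.card Q.roots = N := by
    rw [← hQsplit.natDegree_eq_card_roots, hQ, add_comm]
    rw [natDegree_add_eq_right_of_degree_lt (by rwa [degree_X_pow]), natDegree_X_pow]
  have hQe (w : ℂ) : (Q.roots.map fun a => w - a).prod = w ^ N + p.eval w := by
    rw [← hQsplit.eval_eq_prod_roots_of_monic hQm, hQ]; simp
  have hN0 : N ≠ 0 := by omega
  have hQ0 : (Q.roots.map fun a => -a).prod = p.eval 0 := by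
    have := hQe 0
    simpa [hN0] using this
  have hroots : ∀ a ∈ Q.roots, a ≠ 0 ∧ ‖a‖ < 1 := by
    intro a ha
    have ha' : a ^ N + p.eval a = 0 := by
      have := (mem_roots hQm.ne_zero).1 ha
      simpa [hQ, IsRoot] using this
    have hna : ‖a‖ ^ N = ‖p.eval a‖ := by
      rw [← norm_pow, eq_neg_of_add_eq_zero_left ha', norm_neg]
    refine ⟨?_, ?_⟩
    · rintro rfl
      rw [zero_pow hN0, zero_add] at ha'
      exact hp0 ha'
    · by_contra! h
      rcases le_or_gt ‖a‖ R with h' | h'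
      · have h1 : ‖p.eval a‖ < 1 := hRp (by simpa using h')
        rw [← hna] at h1
        exact absurd (one_le_pow₀ h) (not_le.2 h1)
      · have h1 := hM a h
        rw [← hna, hN, pow_add, mul_comm] at h1
        have h2 : 0 < ‖a‖ ^ d := by positivity
        have h3 := le_of_mul_le_mul_right h1 h2
        have h4 : R ^ k ≤ ‖a‖ ^ k := by gcongr
        linarith
  have hnorm : (Q.roots.map fun a => ‖a‖).prod = ‖p.eval 0‖ := by
    have := map_multiset_prod (normHom : ℂ →*₀ ℝ) (Q.roots.map fun a => -a)
    rw [hQ0, Multiset.map_map] at this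
    simpa using this.symm
  have hp0' : (‖p.eval 0‖ : ℂ) ≠ 0 := by simpa using hp0
  have hκ : (Q.roots.map fun a => -(‖a‖ : ℂ) / a).prod = ‖p.eval 0‖ / p.eval 0 := by
    have h1 := map_multiset_prod Complex.ofRealHom (Q.roots.map fun a => ‖a‖)
    rw [hnorm, Multiset.map_map] at h1
    simp only [Function.comp_def, Complex.ofRealHom_eq_coe] at h1
    rw [h1, ← hQ0, ← Multiset.prod_map_div]
    simp only [neg_div, div_neg]
  refine ⟨Q.roots, ?_, hroots, hnorm, fun z hz0 hzr => ?_⟩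
  · rw [← Multiset.card_pos, hcard]; omega
  have hz : z ≠ 0 := norm_pos_iff.1 hz0
  set w : ℂ := (starRingEnd ℂ) z⁻¹ with hw
  have hzw : z * (starRingEnd ℂ) w = 1 := by rw [hw, Complex.conj_conj, mul_inv_cancel₀ hz]
  have hnw : ‖w‖ = ‖z‖⁻¹ := by rw [hw, RCLike.norm_conj, norm_inv]
  set e : ℂ := z ^ N * (starRingEnd ℂ) (p.eval w) with he
  have hP : (Q.roots.map fun a => 1 - (starRingEnd ℂ) a * z).prod = 1 + e := by
    have h1 : (Q.roots.map fun a => 1 - (starRingEnd ℂ) a * z) =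
        Q.roots.map fun a => z * (starRingEnd ℂ) (w - a) := by
      refine Multiset.map_congr rfl fun a _ => ?_
      rw [map_sub, mul_sub, hzw, mul_comm z]
    have h2 := map_multiset_prod (starRingEnd ℂ) (Q.roots.map fun a => w - a)
    rw [hQe, Multiset.map_map] at h2
    rw [h1, Multiset.prod_map_mul, Multiset.map_const', Multiset.prod_replicate, hcard]
    rw [Function.comp_def] at h2
    rw [← h2, map_add, mul_add, map_pow, ← mul_pow, hzw, one_pow]
  have hη1 : M * ‖z‖ ^ k < min (1 / 2) (ε / 4) := by
    refine lt_of_le_of_lt ?_ hkr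
    gcongr
  have hη2 := hη1.trans_le (min_le_left _ _)
  have hη4 := hη1.trans_le (min_le_right _ _)
  have hz1 : ‖z‖ ≤ 1 := hzr.trans hr.le
  have hen : ‖e‖ ≤ M * ‖z‖ ^ k := by
    have h1 : 1 ≤ ‖w‖ := by rw [hnw]; exact (one_le_inv₀ hz0).2 hz1
    rw [he, norm_mul, norm_pow, RCLike.norm_conj]
    calc ‖z‖ ^ N * ‖p.eval w‖ ≤ ‖z‖ ^ N * (M * ‖w‖ ^ d) := by gcongr; exact hM w h1
      _ = M * ‖z‖ ^ k * (‖z‖ * ‖z‖⁻¹) ^ d := by rw [hnw, hN, pow_add, mul_pow]; ring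
      _ = M * ‖z‖ ^ k := by rw [mul_inv_cancel₀ hz0.ne', one_pow, mul_one]
  have hzN : ‖z ^ N‖ ≤ M * ‖z‖ ^ k := by
    rw [norm_pow, hN, pow_add]
    have : ‖z‖ ^ d ≤ 1 := pow_le_one₀ hz0.le hz1
    gcongr
    exact this.trans hM1
  have he1 : 1 / 2 ≤ ‖1 + e‖ := by
    have := norm_sub_le_norm_add 1 e
    rw [norm_one] at this
    linarith
  have he0 : 1 + e ≠ 0 := norm_pos_iff.1 (by linarith)
  have hpz := hp z (by simpa using hz1)
  have heq : p.eval 0 / ‖p.eval 0‖ * blaschkeProd Q.roots z - p.eval z =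
      (z ^ N - p.eval z * e) / (1 + e) := by
    rw [blaschkeProd_eq_mul, hP, hQe, hκ]
    field_simp
    ring
  rw [heq, norm_div, div_lt_iff₀ (by linarith)]
  calc ‖z ^ N - p.eval z * e‖ ≤ ‖z ^ N‖ + ‖p.eval z‖ * ‖e‖ := by
        rw [← norm_mul]; exact norm_sub_le _ _
    _ ≤ M * ‖z‖ ^ k + 1 * (M * ‖z‖ ^ k) := by gcongr
    _ < ε * (1 / 2) := by linarith
    _ ≤ ε * ‖1 + e‖ := by gcongr

lemma eventually_norm_dilate_sub_lt {g : ℂ → ℂ} (hg : ContinuousOn g (closedBall 0 1)) {ε : ℝ}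
    (hε : 0 < ε) :
    ∀ᶠ r : ℝ in nhdsWithin 1 (Iio 1), ∀ z ∈ sphere (0 : ℂ) 1, ‖g (r * z) - g z‖ < ε := by
  obtain ⟨δ, hδ, h⟩ := Metric.uniformContinuousOn_iff.1
    ((isCompact_closedBall (0 : ℂ) 1).uniformContinuousOn_of_continuous hg) ε hε
  have hmem : Ioo (max 0 (1 - δ)) 1 ∈ nhdsWithin (1 : ℝ) (Iio 1) :=
    Ioo_mem_nhdsLT (by simp [hδ])
  filter_upwards [hmem] with r hr z hz
  have hr0 : 0 < r := (le_max_left _ _).trans_lt hr.1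
  have hrδ : 1 - δ < r := (le_max_right _ _).trans_lt hr.1
  have hz1 : ‖z‖ = 1 := by simpa using hz
  have hnr : ‖(r : ℂ) * z‖ = r := by
    rw [norm_mul, hz1, Complex.norm_real, Real.norm_of_nonneg hr0.le, mul_one]
  rw [← dist_eq_norm]
  refine h _ (by rw [mem_closedBall_zero_iff, hnr]; exact hr.2.le) _ (by simp [hz1]) ?_
  have : (r : ℂ) * z - z = ((r - 1 : ℝ) : ℂ) * z := by push_cast; ring
  rw [dist_eq_norm, this, norm_mul, hz1, Complex.norm_real, Real.norm_eq_abs, mul_one, abs_lt]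
  constructor <;> linarith [hr.2]

/-- One step of the construction: a finite Blaschke product with small Blaschke sum which
approximates `φ` on a dilate of `K`. -/
lemma exists_blaschkeProd_near {K : Set ℂ} (hK : IsCompact K) (hs : K ⊆ sphere (0 : ℂ) 1)
    (h0 : arclength K = 0) (φ : C(K, ℂ)) (hφ : ∀ z, ‖φ z‖ ≤ 1) {ε : ℝ} (hε : 0 < ε)
    {P : ℝ → Prop} (hP : ∀ᶠ r in nhdsWithin 1 (Iio 1), P r) :
    ∃ s : Multiset ℂ, s ≠ 0 ∧ (∀ a ∈ s, a ≠ 0 ∧ ‖a‖ < 1) ∧ (s.map fun a => 1 - ‖a‖).sum < ε ∧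
      ∃ r ∈ Ioo (0 : ℝ) 1, P r ∧ ∀ z : K, ‖blaschkeProd s (r * z) - φ z‖ < ε := by
  have hexp : 0 < 1 - Real.exp (-ε) := by
    have : Real.exp (-ε) < 1 := by rw [Real.exp_lt_one_iff]; linarith
    linarith
  obtain ⟨δ, hδ0, hδε, hδ2, hδexp⟩ : ∃ δ > 0, δ ≤ ε / 16 ∧ δ ≤ 1 / 2 ∧ δ ≤ 1 - Real.exp (-ε) :=
    ⟨min (ε / 16) (min (1 / 2) (1 - Real.exp (-ε))), by positivity, min_le_left _ _,
      (min_le_right _ _).trans (min_le_left _ _), (min_le_right _ _).trans (min_le_right _ _)⟩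
  obtain ⟨f, hf, hf0, hfK⟩ := exists_analytic_approx hK hs h0 φ hφ (half_pos hδ0)
  obtain ⟨p, hp⟩ := exists_polynomial_norm_lt_one_approx hf (half_pos hδ0)
  have hp0 : ‖p.eval 0 - 1‖ < δ := by
    have h1 := (hp 0 (by simp)).2
    have h2 := norm_sub_le_norm_sub_add_norm_sub (p.eval 0) (f 0) 1
    linarith
  have hpK (z : K) : ‖p.eval (z : ℂ) - φ z‖ < δ := by
    have h1 := (hp z (sphere_subset_closedBall (hs z.2))).2
    have h2 := norm_sub_le_norm_sub_add_norm_sub (p.eval (z : ℂ)) (f z) (φ z)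
    linarith [hfK z]
  have hpn : 1 - δ < ‖p.eval 0‖ := by
    have := norm_sub_norm_le (1 : ℂ) (p.eval 0)
    rw [norm_one, norm_sub_rev] at this
    linarith
  have hpn0 : 0 < ‖p.eval 0‖ := by linarith
  have hpn1 : ‖p.eval 0‖ < 1 := (hp 0 (by simp)).1
  have hIoo : ∀ᶠ r in nhdsWithin (1 : ℝ) (Iio 1), r ∈ Ioo (0 : ℝ) 1 := Ioo_mem_nhdsLT zero_lt_one
  obtain ⟨r, hr, hrP, hrp⟩ :=
    (hIoo.and (hP.and (eventually_norm_dilate_sub_lt (g := fun z => p.eval z) (by fun_prop)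
        (ε := ε / 4) (by positivity)))).exists
  obtain ⟨s, hs0, hs1, hsp, hsr⟩ := exists_blaschkeProd_near_polynomial (fun z hz => (hp z hz).1)
    (norm_pos_iff.1 hpn0) hr.1 hr.2 (ε := ε / 4) (by positivity)
  refine ⟨s, hs0, hs1, ?_, r, hr, hrP, fun z => ?_⟩
  · refine (sum_one_sub_norm_le_neg_log hs1).trans_lt ?_
    rw [hsp, neg_lt, Real.lt_log_iff_exp_lt hpn0]
    linarith
  · have hz1 : ‖(z : ℂ)‖ = 1 := by simpa using hs z.2
    have hnr : ‖(r : ℂ) * z‖ = r := by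
      rw [norm_mul, hz1, Complex.norm_real, Real.norm_of_nonneg hr.1.le, mul_one]
    set b := blaschkeProd s (r * z) with hb
    have hb1 : ‖b‖ ≤ 1 := norm_blaschkeProd_le_one hs1 (by rw [hnr]; exact hr.2.le)
    have h1 := hsr (r * z) (by rw [hnr]; exact hr.1) hnr.le
    have h2 := hrp z (hs z.2)
    have h3 := hpK z
    have h4 : ‖b - p.eval 0 / ‖p.eval 0‖ * b‖ ≤ ε / 4 := by
      have hne : (‖p.eval 0‖ : ℂ) ≠ 0 := by exact_mod_cast hpn0.ne'
      have heq : b - p.eval 0 / ‖p.eval 0‖ * b =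
          (((‖p.eval 0‖ - 1 : ℝ) : ℂ) - (p.eval 0 - 1)) / ‖p.eval 0‖ * b := by
        push_cast
        field_simp
        ring
      rw [heq, norm_mul, norm_div, Complex.norm_real, norm_norm]
      have h5 : ‖((‖p.eval 0‖ - 1 : ℝ) : ℂ) - (p.eval 0 - 1)‖ ≤ 2 * δ := by
        refine (norm_sub_le _ _).trans ?_
        rw [Complex.norm_real, Real.norm_eq_abs, abs_of_neg (by linarith)]
        linarith
      refine (mul_le_of_le_one_right (by positivity) hb1).trans ?_
      rw [div_le_iff₀ hpn0]
      nlinarith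
    have h5 := norm_sub_le_norm_sub_add_norm_sub b (p.eval 0 / ‖p.eval 0‖ * b) (φ z)
    have h6 := norm_sub_le_norm_sub_add_norm_sub (p.eval 0 / ‖p.eval 0‖ * b)
      (p.eval ((r : ℂ) * z)) (φ z)
    have h7 := norm_sub_le_norm_sub_add_norm_sub (p.eval ((r : ℂ) * z)) (p.eval (z : ℂ)) (φ z)
    linarith

lemma isInfiniteBlaschke_of_summable {ι : Type*} [Countable ι] [Infinite ι] {w : ι → ℂ}
    (hw0 : ∀ i, w i ≠ 0) (hw1 : ∀ i, ‖w i‖ < 1) (hw : Summable fun i => 1 - ‖w i‖) :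
    ∃ B : ℂ → ℂ, IsInfiniteBlaschke B ∧
      ∀ z ∈ ball (0 : ℂ) 1, HasProd (fun i => blaschkeFactor (w i) z) (B z) := by
  have hprod : ∀ z ∈ ball (0 : ℂ) 1,
      HasProd (fun i => blaschkeFactor (w i) z) (∏' i, blaschkeFactor (w i) z) := by
    intro z hz
    rw [mem_ball_zero_iff] at hz
    have h1 : Summable fun i => ‖blaschkeFactor (w i) z - 1‖ :=
      (hw.mul_left (2 / (1 - ‖z‖))).of_nonneg_of_le (fun _ => norm_nonneg _)
        fun i => norm_blaschkeFactor_sub_one_le (hw0 i) (hw1 i) hz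
    have h2 := multipliable_one_add_of_summable h1
    simp only [add_sub_cancel] at h2
    exact h2.hasProd
  obtain ⟨_⟩ := nonempty_denumerable ι
  let e := (Denumerable.eqv ι).symm
  refine ⟨fun z => ∏' i, blaschkeFactor (w i) z,
    ⟨fun k => -(‖w (e k)‖ : ℂ) / w (e k), w ∘ e, fun k => ?_, fun k => hw1 _,
      e.summable_iff.2 hw, fun z hz => ?_⟩, hprod⟩
  · rw [norm_div, norm_neg, Complex.norm_real, norm_norm, div_self (norm_ne_zero_iff.2 (hw0 _))]
  · exact (e.hasProd_iff.2 (hprod z hz)).tendsto_prod_nat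

lemma exists_isInfiniteBlaschke_hasProd {s : ℕ → Multiset ℂ} (hs0 : ∀ n, s n ≠ 0)
    (hs : ∀ n, ∀ a ∈ s n, a ≠ 0 ∧ ‖a‖ < 1)
    (hsum : Summable fun n => ((s n).map fun a => 1 - ‖a‖).sum) :
    ∃ B : ℂ → ℂ, IsInfiniteBlaschke B ∧
      ∀ z ∈ ball (0 : ℂ) 1, HasProd (fun n => blaschkeProd (s n) z) (B z) := by
  have hinf : Infinite (Σ n, s n) := by
    refine Infinite.of_surjective Sigma.fst fun n => ?_
    obtain ⟨a, ha⟩ := Multiset.exists_mem_of_ne_zero (hs0 n)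
    exact ⟨⟨n, ⟨a, ⟨0, Multiset.count_pos.2 ha⟩⟩⟩, rfl⟩
  have hmem (i : Σ n, s n) := hs i.1 i.2 Multiset.coe_mem
  have hw : Summable fun i : (Σ n, s n) => 1 - ‖(i.2 : ℂ)‖ := by
    refine (summable_sigma_of_nonneg fun i => by linarith [(hmem i).2]).2
      ⟨fun n => (hasSum_fintype _).summable, ?_⟩
    refine hsum.congr fun n => ?_
    rw [tsum_fintype, Finset.sum_eq_multiset_sum, Multiset.map_univ (s n) fun a => 1 - ‖a‖]
  obtain ⟨B, hB, hBz⟩ := isInfiniteBlaschke_of_summable (w := fun i : (Σ n, s n) => (i.2 : ℂ))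
    (fun i => (hmem i).1) (fun i => (hmem i).2) hw
  refine ⟨B, hB, fun z hz => (hBz z hz).sigma fun n => ?_⟩
  have h := hasProd_fintype fun i : s n => blaschkeFactor (i : ℂ) z
  rwa [Finset.prod_eq_multiset_prod, Multiset.map_univ (s n) fun a => blaschkeFactor a z] at h

lemma norm_sub_prod_range_le {b : ℕ → ℂ} {c : ℂ} (hc : HasProd b c) (hb : ∀ n, ‖b n‖ ≤ 1) {n : ℕ}
    (hbn : ∀ m ≥ n, ‖b m - 1‖ ≤ 2 * (1 / 2) ^ m) :
    ‖c - ∏ i ∈ Finset.range n, b i‖ ≤ 4 * (1 / 2) ^ n := by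
  have h1 : Tendsto (fun k => ∏ i ∈ Finset.range (k + n), b i) atTop (nhds c) :=
    (tendsto_add_atTop_iff_nat n).2 hc.tendsto_prod_nat
  have h2 (k : ℕ) : dist (∏ i ∈ Finset.range (k + n), b i) (∏ i ∈ Finset.range (k + 1 + n), b i) ≤
      4 * (1 / 2) ^ n / 2 / 2 ^ k := by
    rw [show k + 1 + n = k + n + 1 by ring, Finset.prod_range_succ, dist_comm, dist_eq_norm,
      ← mul_sub_one, norm_mul]
    have h3 : ‖∏ i ∈ Finset.range (k + n), b i‖ ≤ 1 := by
      rw [norm_prod]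
      exact Finset.prod_le_one (fun _ _ => norm_nonneg _) fun i _ => hb i
    refine (mul_le_of_le_one_left (norm_nonneg _) h3).trans ((hbn _ (by omega)).trans_eq ?_)
    rw [pow_add, one_div, inv_pow]
    ring
  have h3 := dist_le_of_le_geometric_two_of_tendsto₀ h2 h1
  rwa [dist_comm, dist_eq_norm, zero_add] at h3

lemma exists_blaschkeProd_add_near {K : Set ℂ} (hK : IsCompact K) (hs : K ⊆ sphere (0 : ℂ) 1)
    (h0 : arclength K = 0) (φ : C(K, ℂ)) (hφ : ∀ z, ‖φ z‖ ≤ 1) {t : Multiset ℂ}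
    (ht : ∀ a ∈ t, a ≠ 0 ∧ ‖a‖ < 1) {ε ε' ρ : ℝ} (hε : 0 < ε) (hε' : 0 < ε') (hρ : ρ < 1) :
    ∃ s : Multiset ℂ, s ≠ 0 ∧ (∀ a ∈ s, a ≠ 0 ∧ ‖a‖ < 1) ∧ (s.map fun a => 1 - ‖a‖).sum < ε' ∧
      ∃ r ∈ Ioo (0 : ℝ) 1, ρ < r ∧ ∀ z : K, ‖blaschkeProd (t + s) (r * z) - φ z‖ < ε := by
  have hcont := continuousOn_blaschkeProd ht
  have hK1 (z : K) : ‖(z : ℂ)‖ = 1 := by simpa using hs z.2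
  have hcK : Continuous fun z : K => blaschkeProd t z :=
    hcont.comp_continuous continuous_subtype_val fun z => by simp [hK1 z]
  let ψ : C(K, ℂ) := ⟨fun z => φ z * (starRingEnd ℂ) (blaschkeProd t z), by fun_prop⟩
  have hψ (z : K) : ‖ψ z‖ ≤ 1 := by
    change ‖φ z * (starRingEnd ℂ) (blaschkeProd t z)‖ ≤ 1
    rw [norm_mul, RCLike.norm_conj, norm_blaschkeProd_eq_one ht (hK1 z), mul_one]
    exact hφ z
  have hψφ (z : K) : blaschkeProd t z * ψ z = φ z := by
    change blaschkeProd t z * (φ z * (starRingEnd ℂ) (blaschkeProd t z)) = φ z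
    rw [mul_left_comm, Complex.mul_conj', norm_blaschkeProd_eq_one ht (hK1 z)]
    simp
  obtain ⟨s, hs0, hs1, hss, r, hr, ⟨hρr, hrt⟩, hrs⟩ := exists_blaschkeProd_near hK hs h0 ψ hψ
    (ε := min ε' (ε / 2)) (by positivity)
    ((eventually_nhdsWithin_of_eventually_nhds (eventually_gt_nhds hρ)).and
      (eventually_norm_dilate_sub_lt hcont (half_pos hε)))
  refine ⟨s, hs0, hs1, hss.trans_le (min_le_left _ _), r, hr, hρr, fun z => ?_⟩
  have h1 := hrt z (hs z.2)
  have h2 := (hrs z).trans_le (min_le_right _ _)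
  have hsn : ‖blaschkeProd s (r * z)‖ ≤ 1 := by
    refine norm_blaschkeProd_le_one hs1 ?_
    rw [norm_mul, hK1, Complex.norm_real, Real.norm_of_nonneg hr.1.le, mul_one]
    exact hr.2.le
  calc ‖blaschkeProd (t + s) (r * z) - φ z‖
      = ‖(blaschkeProd t (r * z) - blaschkeProd t z) * blaschkeProd s (r * z) +
          blaschkeProd t z * (blaschkeProd s (r * z) - ψ z)‖ := by
        rw [blaschkeProd_add, ← hψφ]; ring_nf
    _ ≤ ‖blaschkeProd t (r * z) - blaschkeProd t z‖ * ‖blaschkeProd s (r * z)‖ +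
          ‖blaschkeProd t z‖ * ‖blaschkeProd s (r * z) - ψ z‖ := by
        rw [← norm_mul, ← norm_mul]; exact norm_add_le _ _
    _ ≤ ‖blaschkeProd t (r * z) - blaschkeProd t z‖ * 1 +
          1 * ‖blaschkeProd s (r * z) - ψ z‖ := by
        rw [norm_blaschkeProd_eq_one ht (hK1 z)]; gcongr
    _ < ε := by linarith

lemma exists_seq_blaschkeProd_near {K : Set ℂ} (hK : IsCompact K) (hs : K ⊆ sphere (0 : ℂ) 1)
    (h0 : arclength K = 0) (φ : ℕ → C(K, ℂ)) (hφ : ∀ n z, ‖φ n z‖ ≤ 1) :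
    ∃ (s : ℕ → Multiset ℂ) (ρ : ℕ → ℝ), (∀ n, s n ≠ 0) ∧
      (∀ n, ∀ a ∈ s n, a ≠ 0 ∧ ‖a‖ < 1) ∧ (∀ n, ρ n ∈ Ico (0 : ℝ) 1) ∧ StrictMono ρ ∧
      (∀ n : ℕ, 1 - 1 / ((n : ℝ) + 1) < ρ (n + 1)) ∧
      (∀ n, ((s n).map fun a => 1 - ‖a‖).sum < (1 / 2) ^ n * (1 - ρ n)) ∧
      ∀ n (z : K), ‖∏ i ∈ Finset.range (n + 1), blaschkeProd (s i) (ρ (n + 1) * z) - φ n z‖ <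
        (1 / 2) ^ n := by
  let S := {x : Multiset ℂ × ℝ // (∀ a ∈ x.1, a ≠ 0 ∧ ‖a‖ < 1) ∧ x.2 ∈ Ico (0 : ℝ) 1}
  have hstep (n : ℕ) (x : S) : ∃ y : S, ∃ s : Multiset ℂ, s ≠ 0 ∧ (∀ a ∈ s, a ≠ 0 ∧ ‖a‖ < 1) ∧
      y.1.1 = x.1.1 + s ∧ (s.map fun a => 1 - ‖a‖).sum < (1 / 2) ^ n * (1 - x.1.2) ∧
      x.1.2 < y.1.2 ∧ 1 - 1 / ((n : ℝ) + 1) < y.1.2 ∧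
      ∀ z : K, ‖blaschkeProd y.1.1 (y.1.2 * z) - φ n z‖ < (1 / 2) ^ n := by
    obtain ⟨⟨t, ρ⟩, ht, hρ⟩ := x
    have hn : (0 : ℝ) < 1 / ((n : ℝ) + 1) := by positivity
    obtain ⟨s, hs0, hs1, hss, r, hr, hρr, hrs⟩ := exists_blaschkeProd_add_near hK hs h0 (φ n) (hφ n)
      ht (ε := (1 / 2) ^ n) (ε' := (1 / 2) ^ n * (1 - ρ)) (ρ := max ρ (1 - 1 / ((n : ℝ) + 1)))
      (by positivity) (mul_pos (by positivity) (by linarith [hρ.2]))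
      (max_lt hρ.2 (by linarith))
    refine ⟨⟨(t + s, r), fun a ha => ?_, hr.1.le, hr.2⟩, s, hs0, hs1, rfl, hss,
      (le_max_left _ _).trans_lt hρr, (le_max_right _ _).trans_lt hρr, hrs⟩
    exact (Multiset.mem_add.1 ha).elim (ht a) (hs1 a)
  choose f s hs0 hs1 hfs hsum hlt hgt hnear using hstep
  let x : ℕ → S := fun n => Nat.rec ⟨(0, 0), by simp, by simp⟩ f n
  have hx (n : ℕ) : x (n + 1) = f n (x n) := rfl
  refine ⟨fun n => s n (x n), fun n => (x n).1.2, fun n => hs0 _ _, fun n => hs1 _ _,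
    fun n => (x n).2.2, strictMono_nat_of_lt_succ fun n => hlt _ _, fun n => hgt _ _,
    fun n => hsum _ _, fun n z => ?_⟩
  have hprod (m : ℕ) (w : ℂ) :
      ∏ i ∈ Finset.range m, blaschkeProd (s i (x i)) w = blaschkeProd (x m).1.1 w := by
    induction m with
    | zero => rw [Finset.prod_range_zero]; exact (blaschkeProd_zero w).symm
    | succ m ih => rw [Finset.prod_range_succ, ih, hx, hfs, blaschkeProd_add]
  rw [hprod]
  exact hnear _ _ _

/-- Every sequence in the closed unit ball of `C(K)` is approximated by dilates of a single
infinite Blaschke product. -/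
lemma exists_isInfiniteBlaschke_near_seq {K : Set ℂ} (hK : IsCompact K)
    (hs : K ⊆ sphere (0 : ℂ) 1) (h0 : arclength K = 0) (φ : ℕ → C(K, ℂ))
    (hφ : ∀ n z, ‖φ n z‖ ≤ 1) :
    ∃ (B : ℂ → ℂ) (r : ℕ → ℝ), IsInfiniteBlaschke B ∧ (∀ n, r n ∈ Ioo (0 : ℝ) 1) ∧
      Tendsto r atTop (nhds 1) ∧ ∀ n (z : K), ‖B (r n * z) - φ n z‖ ≤ 3 * (1 / 2) ^ n := by
  obtain ⟨s, ρ, hs0, hs1, hρ, hmono, hgt, hsum, hnear⟩ :=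
    exists_seq_blaschkeProd_near hK hs h0 φ hφ
  have hnn (n : ℕ) : 0 ≤ ((s n).map fun a => 1 - ‖a‖).sum := by
    refine Multiset.sum_nonneg fun x hx => ?_
    obtain ⟨a, ha, rfl⟩ := Multiset.mem_map.1 hx
    linarith [(hs1 n a ha).2]
  have hle (n : ℕ) : ((s n).map fun a => 1 - ‖a‖).sum ≤ (1 / 2) ^ n := by
    refine (hsum n).le.trans (mul_le_of_le_one_right (by positivity) ?_)
    linarith [(hρ n).1]
  obtain ⟨B, hB, hBz⟩ := exists_isInfiniteBlaschke_hasProd hs0 hs1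
    (summable_geometric_two.of_nonneg_of_le hnn hle)
  have hρ0 (n : ℕ) : 0 < ρ (n + 1) := (hρ 0).1.trans_lt (hmono n.succ_pos)
  refine ⟨B, fun n => ρ (n + 1), hB, fun n => ⟨hρ0 n, (hρ _).2⟩, ?_, fun n z => ?_⟩
  · refine tendsto_of_tendsto_of_tendsto_of_le_of_le ?_ tendsto_const_nhds
      (fun n => (hgt n).le) fun n => (hρ _).2.le
    simpa using (tendsto_one_div_add_atTop_nhds_zero_nat (𝕜 := ℝ)).const_sub 1
  have hz1 : ‖(z : ℂ)‖ = 1 := by simpa using hs z.2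
  set w : ℂ := ρ (n + 1) * z with hw
  have hnw : ‖w‖ = ρ (n + 1) := by
    rw [hw, norm_mul, hz1, Complex.norm_real, Real.norm_of_nonneg (hρ0 n).le, mul_one]
  have hw1 : ‖w‖ < 1 := by rw [hnw]; exact (hρ _).2
  have h1 := norm_sub_prod_range_le (hBz w (mem_ball_zero_iff.2 hw1))
    (fun m => norm_blaschkeProd_le_one (hs1 m) hw1.le) (n := n + 1) fun m hm => by
      refine (norm_blaschkeProd_sub_one_le (hs1 m) hw1).trans ?_
      have h2 := hmono.monotone hm
      have h3 : 0 < 1 - ‖w‖ := by linarith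
      rw [div_mul_eq_mul_div, div_le_iff₀ h3, mul_assoc]
      gcongr
      refine (hsum m).le.trans ?_
      rw [hnw]
      gcongr
  have h2 := hnear n z
  have h3 := norm_sub_le_norm_sub_add_norm_sub (B w)
    (∏ i ∈ Finset.range (n + 1), blaschkeProd (s i) w) (φ n z)
  rw [pow_succ] at h1
  linarith

/-- There is an infinite Blaschke product whose dilates approximate every function in the
closed unit ball of `C(K)` uniformly on `K`, for `K ⊆ 𝕋` compact of arclength measure 0. -/
theorem exists_universal_blaschke (K : Set ℂ) (hKc : IsCompact K)
    (hKs : K ⊆ Metric.sphere (0:ℂ) 1) (hK0 : arclength K = 0) :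
    ∃ B : ℂ → ℂ, IsInfiniteBlaschke B ∧
      ∀ φ : ℂ → ℂ, ContinuousOn φ K → (∀ z ∈ K, ‖φ z‖ ≤ 1) →
        ∃ r : ℕ → ℝ, (∀ n, r n ∈ Set.Ioo (0:ℝ) 1) ∧ Tendsto r atTop (nhds 1) ∧
          Tendsto (fun n => ⨆ z ∈ K, ‖B ((r n : ℂ) * z) - φ z‖) atTop (nhds 0) := by
  have : CompactSpace K := isCompact_iff_compactSpace.1 hKc
  let U := {φ : C(K, ℂ) // ∀ z, ‖φ z‖ ≤ 1}
  have : Nonempty U := ⟨⟨0, fun z => by simp⟩⟩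
  let d : ℕ → U := TopologicalSpace.denseSeq U
  have hd : DenseRange d := TopologicalSpace.denseRange_denseSeq U
  obtain ⟨B, r, hB, hr, hr1, hnear⟩ := exists_isInfiniteBlaschke_near_seq hKc hKs hK0
    (fun n => (d n.unpair.1).1) fun n => (d n.unpair.1).2
  refine ⟨B, hB, fun φ hφc hφ => ?_⟩
  let Φ : U := ⟨⟨K.domRestrict φ, hφc.domRestrict⟩, fun z => hφ z z.2⟩
  choose i hi using fun j : ℕ => hd.exists_dist_lt Φ (Nat.one_div_pos_of_nat (α := ℝ) (n := j))
  have hle (j : ℕ) : j ≤ Nat.pair (i j) j := Nat.right_le_pair _ _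
  refine ⟨fun j => r (Nat.pair (i j) j), fun j => hr _,
    hr1.comp (tendsto_atTop_mono hle tendsto_id), ?_⟩
  have hlim : Tendsto (fun j : ℕ => 3 * (1 / 2 : ℝ) ^ j + 1 / ((j : ℝ) + 1)) atTop (nhds 0) := by
    have h1 := (tendsto_pow_atTop_nhds_zero_of_lt_one (r := (1 / 2 : ℝ)) (by norm_num)
      (by norm_num)).const_mul 3
    simpa using h1.add (tendsto_one_div_add_atTop_nhds_zero_nat (𝕜 := ℝ))
  refine squeeze_zero (fun j => Real.iSup_nonneg fun z => Real.iSup_nonneg fun _ => norm_nonneg _)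
    (fun j => ?_) hlim
  refine Real.iSup_le (fun z => Real.iSup_le (fun hz => ?_) (by positivity)) (by positivity)
  have h1 := hnear (Nat.pair (i j) j) ⟨z, hz⟩
  rw [Nat.unpair_pair] at h1
  have h2 : ‖(d (i j)).1 ⟨z, hz⟩ - φ z‖ ≤ dist Φ (d (i j)) := by
    rw [dist_comm, ← dist_eq_norm]
    exact ContinuousMap.dist_apply_le_dist (f := (d (i j)).1) (g := Φ.1) ⟨z, hz⟩
  have h3 : (1 / 2 : ℝ) ^ Nat.pair (i j) j ≤ (1 / 2) ^ j :=
    pow_le_pow_of_le_one (by norm_num) (by norm_num) (hle j)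
  have h4 := norm_sub_le_norm_sub_add_norm_sub (B (r (Nat.pair (i j) j) * z))
    ((d (i j)).1 ⟨z, hz⟩) (φ z)
  linarith [hi j]
end
end
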